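/- arXiv:2008.06613 — 3 statements merged into one kernel-verified Lean document; each statement's English description precedes it below -/
import Mathlib

section
/- For every countable ordinal α with α ≥ 2, the iterated ℤ-jump Z_α is Borel reducible to the Friedman–Stanley iterate F_α. -/
/-- The Γ-jump of an equivalence relation `E` on `X`. -/
def GammaJump (Γ : Type*) [Group Γ] {X : Type*} (E : X → X → Prop) :
    (Γ → X) → (Γ → X) → Prop :=
  fun x y => ∃ γ : Γ, ∀ α : Γ, E (x (γ⁻¹ * α)) (y α)

/-- A (Borel) equivalence relation: a carrier with a σ-algebra and a binary relation. -/
structure BorelEqvRel : Type 2 where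
  carrier : Type 1
  ms : MeasurableSpace carrier
  rel : carrier → carrier → Prop

/-- Borel reducibility between packaged equivalence relations. -/
def RedB (E F : BorelEqvRel) : Prop :=
  ∃ f : E.carrier → F.carrier, @Measurable _ _ E.ms F.ms f ∧
    ∀ x y, E.rel x y ↔ F.rel (f x) (f y)

/-- The Γ-jump of a packaged equivalence relation. -/
def jumpB (Γ : Type) [Group Γ] (R : BorelEqvRel) : BorelEqvRel where
  carrier := Γ → R.carrier
  ms := @MeasurableSpace.pi _ _ (fun _ => R.ms)
  rel := GammaJump Γ R.rel

/-- The direct sum of a family of packaged equivalence relations: two points are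
equivalent iff they lie in the same summand and are equivalent there. -/
def sumB {ι : Type 1} (f : ι → BorelEqvRel) : BorelEqvRel where
  carrier := Σ i : ι, (f i).carrier
  ms := letI := fun i => (f i).ms; inferInstance
  rel a b := ∃ (i : ι) (x y : (f i).carrier), (f i).rel x y ∧ a = ⟨i, x⟩ ∧ b = ⟨i, y⟩

/-- The Friedman–Stanley jump of a packaged equivalence relation. -/
def fsJumpB (R : BorelEqvRel) : BorelEqvRel where
  carrier := ℕ → R.carrier
  ms := @MeasurableSpace.pi _ _ (fun _ => R.ms)
  rel x y :=
    Set.range (fun n => {z | R.rel (x n) z}) = Set.range (fun n => {z | R.rel (y n) z})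

/-- The iterated Γ-jumps of `E`: `J^0 = E`, `J^{α+1} = (J^α)^{[Γ]}`, and
`J^λ = (⊕_{α<λ} J^α)^{[Γ]}` for limit `λ`. -/
noncomputable def iterJump (Γ : Type) [Group Γ] (E : BorelEqvRel) (o : Ordinal) :
    BorelEqvRel :=
  Ordinal.limitRecOn o E (fun _ ih => jumpB Γ ih)
    (fun o _ ih => jumpB Γ (sumB (fun i : {β : Ordinal // β < o} => ih i.1 i.2)))

/-- `Δ(2)`: the identity relation on a two-element set. -/
def deltaTwo : BorelEqvRel := ⟨ULift Bool, ⊤, Eq⟩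

/-- `Z_α`: the iterated ℤ-jump of `Δ(2)`. -/
noncomputable def Zrel (o : Ordinal) : BorelEqvRel :=
  iterJump (Multiplicative ℤ) deltaTwo o

/-- The Friedman–Stanley tower: `F_0 = Δ(ω)`, `F_{α+1} = (F_α)⁺`, and
`F_λ = (⊕_{α<λ} F_α)⁺` for limit `λ`. -/
noncomputable def FStower (o : Ordinal) : BorelEqvRel :=
  Ordinal.limitRecOn o ⟨ULift ℕ, ⊤, Eq⟩ (fun _ ih => fsJumpB ih)
    (fun o _ ih => fsJumpB (sumB (fun i : {β : Ordinal // β < o} => ih i.1 i.2)))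

/-! ### Borel reductions between unbundled relations -/

section Unbundled

variable {X Y Z : Type*} [MeasurableSpace X] [MeasurableSpace Y] [MeasurableSpace Z]

/-- `E` is Borel reducible to `F`. -/
def BorelRed (E : X → X → Prop) (F : Y → Y → Prop) : Prop :=
  ∃ f : X → Y, Measurable f ∧ ∀ x y, E x y ↔ F (f x) (f y)

/-- A countably multivalued Borel reduction: the classes of the values `e m x` depend only on the
`E`-class of `x`, and inequivalent points have no equivalent values. -/
def MultiBorelRed (E : X → X → Prop) (F : Y → Y → Prop) : Prop :=
  ∃ e : ℕ → X → Y, (∀ m, Measurable (e m)) ∧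
    (∀ x y, E x y → ∀ m, ∃ m', F (e m x) (e m' y)) ∧
    ∀ x y m m', F (e m x) (e m' y) → E x y

/-- The product of two relations. -/
def prodRel {X Y : Type*} (E : X → X → Prop) (F : Y → Y → Prop) : X × Y → X × Y → Prop :=
  fun a b => E a.1 b.1 ∧ F a.2 b.2

/-- `E × Δ(2)` is Borel reducible to `E`. -/
def Doubling (E : X → X → Prop) : Prop :=
  BorelRed (prodRel E (Eq : Bool → Bool → Prop)) E

/-- `E × E` is Borel reducible to `E`. -/
def Pairing (E : X → X → Prop) : Prop :=
  BorelRed (prodRel E E) E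

/-- The identity relation on the Cantor space is Borel reducible to `E`. -/
def CodesReals (E : X → X → Prop) : Prop :=
  BorelRed (Eq : (ℕ → Bool) → (ℕ → Bool) → Prop) E

/-- The Friedman–Stanley jump. -/
def fsRel {X : Type*} (E : X → X → Prop) : (ℕ → X) → (ℕ → X) → Prop := fun x y =>
  Set.range (fun n => {z | E (x n) z}) = Set.range (fun n => {z | E (y n) z})

/-- The direct sum of a family of relations. -/
def sumRel {ι : Type*} {X : ι → Type*} (E : ∀ i, X i → X i → Prop) :
    (Σ i, X i) → (Σ i, X i) → Prop := fun a b =>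
  ∃ (i : ι) (x y : X i), E i x y ∧ a = ⟨i, x⟩ ∧ b = ⟨i, y⟩

theorem BorelRed.refl (E : X → X → Prop) : BorelRed E E :=
  ⟨id, measurable_id, fun _ _ => Iff.rfl⟩

theorem BorelRed.trans {E : X → X → Prop} {F : Y → Y → Prop} {G : Z → Z → Prop}
    (h : BorelRed E F) (h' : BorelRed F G) : BorelRed E G := by
  obtain ⟨f, hf, hfr⟩ := h
  obtain ⟨g, hg, hgr⟩ := h'
  exact ⟨g ∘ f, hg.comp hf, fun x y => (hfr x y).trans (hgr _ _)⟩

theorem BorelRed.multi {E : X → X → Prop} {F : Y → Y → Prop} (h : BorelRed E F) :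
    MultiBorelRed E F := by
  obtain ⟨f, hf, hfr⟩ := h
  exact ⟨fun _ => f, fun _ => hf, fun x y hxy m => ⟨m, (hfr x y).1 hxy⟩,
    fun x y _ _ hxy => (hfr x y).2 hxy⟩

theorem MultiBorelRed.trans {E : X → X → Prop} {F : Y → Y → Prop} {G : Z → Z → Prop}
    (h : MultiBorelRed E F) (h' : BorelRed F G) : MultiBorelRed E G := by
  obtain ⟨e, he, h1, h2⟩ := h
  obtain ⟨g, hg, hgr⟩ := h'
  refine ⟨fun m => g ∘ e m, fun m => hg.comp (he m), fun x y hxy m => ?_, fun x y m m' hxy => ?_⟩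
  · obtain ⟨m', hm'⟩ := h1 x y hxy m
    exact ⟨m', (hgr _ _).1 hm'⟩
  · exact h2 x y m m' ((hgr _ _).2 hxy)

theorem bool_toNat_injective : Function.Injective Bool.toNat := by decide

/-! ### The Friedman–Stanley jump -/

theorem fsRel_iff {X : Type*} {E : X → X → Prop} (hE : Equivalence E) (x y : ℕ → X) :
    fsRel E x y ↔ (∀ n, ∃ m, E (x n) (y m)) ∧ ∀ m, ∃ n, E (x n) (y m) := by
  have key : ∀ a b : X, {z | E a z} = {z | E b z} ↔ E a b := by
    intro a b
    constructor
    · intro h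
      have : b ∈ {z | E a z} := by rw [h]; exact hE.refl b
      exact this
    · intro h
      ext z
      exact ⟨fun hz => hE.trans (hE.symm h) hz, fun hz => hE.trans h hz⟩
  constructor
  · intro h
    constructor
    · intro n
      have : {z | E (x n) z} ∈ Set.range (fun n => {z | E (y n) z}) := by
        rw [← show _ = _ from h]; exact ⟨n, rfl⟩
      obtain ⟨m, hm⟩ := this
      exact ⟨m, (key _ _).1 hm.symm⟩
    · intro m
      have : {z | E (y m) z} ∈ Set.range (fun n => {z | E (x n) z}) := by
        rw [show _ = _ from h]; exact ⟨m, rfl⟩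
      obtain ⟨n, hn⟩ := this
      exact ⟨n, (key _ _).1 hn⟩
  · rintro ⟨h1, h2⟩
    apply Set.Subset.antisymm
    · rintro _ ⟨n, rfl⟩
      obtain ⟨m, hm⟩ := h1 n
      exact ⟨m, ((key _ _).2 hm).symm⟩
    · rintro _ ⟨m, rfl⟩
      obtain ⟨n, hn⟩ := h2 m
      exact ⟨n, (key _ _).2 hn⟩

theorem fsRel_comp_iff {X ι : Type*} {E : X → X → Prop} (hE : Equivalence E) {φ : ℕ → ι}
    (hφ : Function.Surjective φ) (x y : ι → X) :
    fsRel E (x ∘ φ) (y ∘ φ) ↔ (∀ i, ∃ j, E (x i) (y j)) ∧ ∀ j, ∃ i, E (x i) (y j) := by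
  rw [fsRel_iff hE]
  simp only [Function.comp_apply, hφ.forall, hφ.exists]

theorem fsRel_equivalence {X : Type*} (E : X → X → Prop) : Equivalence (fsRel E) :=
  ⟨fun _ => rfl, fun h => Eq.symm h, fun h h' => Eq.trans h h'⟩

theorem BorelRed.to_fsRel {E : X → X → Prop} (hE : Equivalence E) : BorelRed E (fsRel E) := by
  refine ⟨fun x _ => x, measurable_pi_iff.2 fun _ => measurable_id, fun x y => ?_⟩
  rw [fsRel_iff hE]
  simp

theorem Doubling.to_fsRel {E : X → X → Prop} (hE : Equivalence E) (h : Doubling E) :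
    Doubling (fsRel E) := by
  obtain ⟨d, hd, hdr⟩ := h
  refine ⟨fun p n => d (p.1 n, p.2), ?_, ?_⟩
  · exact measurable_pi_iff.2 fun n =>
      hd.comp (((measurable_pi_apply n).comp measurable_fst).prodMk measurable_snd)
  · rintro ⟨x, b⟩ ⟨y, c⟩
    rw [fsRel_iff hE]
    simp only [← hdr]
    simp only [prodRel, fsRel_iff hE]
    constructor
    · rintro ⟨⟨h1, h2⟩, rfl⟩
      exact ⟨fun n => (h1 n).imp fun _ h => ⟨h, rfl⟩, fun n => (h2 n).imp fun _ h => ⟨h, rfl⟩⟩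
    · rintro ⟨h1, h2⟩
      exact ⟨⟨fun n => (h1 n).imp fun _ h => h.1, fun n => (h2 n).imp fun _ h => h.1⟩,
        (h1 0).choose_spec.2⟩

theorem Doubling.pairing_fsRel {E : X → X → Prop} (hE : Equivalence E) (h : Doubling E) :
    Pairing (fsRel E) := by
  obtain ⟨d, hd, hdr⟩ := h
  let w : (ℕ → X) × (ℕ → X) → ℕ ⊕ ℕ → X := fun p =>
    Sum.elim (fun k => d (p.1 k, false)) (fun k => d (p.2 k, true))
  refine ⟨fun p => w p ∘ Equiv.natSumNatEquivNat.symm, ?_, ?_⟩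
  · refine measurable_pi_iff.2 fun n => ?_
    simp only [Function.comp_apply]
    rcases Equiv.natSumNatEquivNat.symm n with k | k
    · exact hd.comp (((measurable_pi_apply k).comp measurable_fst).prodMk measurable_const)
    · exact hd.comp (((measurable_pi_apply k).comp measurable_snd).prodMk measurable_const)
  · rintro ⟨x, x'⟩ ⟨y, y'⟩
    rw [fsRel_comp_iff hE Equiv.natSumNatEquivNat.symm.surjective]
    simp only [w, Sum.forall, Sum.exists, Sum.elim_inl, Sum.elim_inr, ← hdr]
    simp only [prodRel, fsRel_iff hE]
    simp only [and_true, reduceCtorEq, and_false, exists_false, or_false, false_or]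
    tauto

theorem codesReals_fsRel_eq : CodesReals (fsRel (Eq : ULift ℕ → ULift ℕ → Prop)) := by
  refine ⟨fun a n => ⟨2 * n + (a n).toNat⟩, ?_, ?_⟩
  · refine measurable_pi_iff.2 fun n => ?_
    exact (measurable_of_countable fun b : Bool => (⟨2 * n + b.toNat⟩ : ULift ℕ)).comp
      (measurable_pi_apply n)
  · intro x y
    rw [fsRel_iff eq_equivalence]
    constructor
    · rintro rfl
      exact ⟨fun n => ⟨n, rfl⟩, fun n => ⟨n, rfl⟩⟩
    · rintro ⟨h1, -⟩
      funext n
      obtain ⟨m, hm⟩ := h1 n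
      simp only [ULift.up.injEq] at hm
      have hx := Bool.toNat_le (x n)
      have hy := Bool.toNat_le (y m)
      obtain rfl : n = m := by omega
      exact bool_toNat_injective (by omega)

end Unbundled

/-! ### Direct sums -/

section Sum

variable {ι : Type*} {X : ι → Type*} [∀ i, MeasurableSpace (X i)]

theorem sumRel_mk {ι : Type*} {X : ι → Type*} {E : ∀ i, X i → X i → Prop} {i : ι} {x y : X i} :
    sumRel E ⟨i, x⟩ ⟨i, y⟩ ↔ E i x y := by
  constructor
  · rintro ⟨j, a, b, hab, h1, h2⟩
    cases h1
    cases h2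
    exact hab
  · exact fun h => ⟨i, x, y, h, rfl, rfl⟩

theorem sumRel_fst {ι : Type*} {X : ι → Type*} {E : ∀ i, X i → X i → Prop} {a b : Σ i, X i} (h : sumRel E a b) :
    a.1 = b.1 := by
  obtain ⟨j, a, b, -, rfl, rfl⟩ := h
  rfl

theorem sumRel_equivalence {ι : Type*} {X : ι → Type*} {E : ∀ i, X i → X i → Prop} (hE : ∀ i, Equivalence (E i)) :
    Equivalence (sumRel E) := by
  refine ⟨fun a => ⟨a.1, a.2, a.2, (hE _).refl _, rfl, rfl⟩, ?_, ?_⟩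
  · rintro _ _ ⟨i, x, y, h, rfl, rfl⟩
    exact ⟨i, y, x, (hE i).symm h, rfl, rfl⟩
  · rintro _ _ ⟨k, z⟩ ⟨i, x, y, h, rfl, rfl⟩ h'
    obtain rfl : i = k := sumRel_fst h'
    exact sumRel_mk.2 ((hE i).trans h (sumRel_mk.1 h'))

theorem measurableSet_sigma_iff {s : Set (Σ i, X i)} :
    MeasurableSet s ↔ ∀ i, MeasurableSet (Sigma.mk i ⁻¹' s) := by
  rw [Sigma.instMeasurableSpace, MeasurableSpace.measurableSet_iInf]
  rfl

theorem measurable_sigma_mk (i : ι) : Measurable (Sigma.mk i : X i → Σ i, X i) :=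
  fun _ hs => measurableSet_sigma_iff.1 hs i

theorem measurable_sigma_iff {Y : Type*} [MeasurableSpace Y] {f : (Σ i, X i) → Y} :
    Measurable f ↔ ∀ i, Measurable fun x => f ⟨i, x⟩ :=
  ⟨fun h i => h.comp (measurable_sigma_mk i),
    fun h _ hs => measurableSet_sigma_iff.2 fun i => h i hs⟩

theorem measurableEmbedding_sigma_mk (i : ι) :
    MeasurableEmbedding (Sigma.mk i : X i → Σ i, X i) where
  injective := sigma_mk_injective
  measurable := measurable_sigma_mk i
  measurableSet_image' := by
    intro s hs
    refine measurableSet_sigma_iff.2 fun j => ?_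
    by_cases h : i = j
    · subst h
      rwa [Set.preimage_image_eq _ sigma_mk_injective]
    · convert MeasurableSet.empty
      ext x
      simp only [Set.mem_preimage, Set.mem_image, Set.mem_empty_iff_false, iff_false]
      rintro ⟨a, -, ha⟩
      exact h (congrArg Sigma.fst ha)

theorem measurable_sigma_prod [Countable ι] {Y : Type*} [MeasurableSpace Y]
    {f : (Σ i, X i) × (Σ i, X i) → Y}
    (h : ∀ i j, Measurable fun p : X i × X j => f (⟨i, p.1⟩, ⟨j, p.2⟩)) : Measurable f := by
  intro s hs
  have : f ⁻¹' s = ⋃ (i : ι) (j : ι), Prod.map (Sigma.mk i) (Sigma.mk j) ''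
      ((fun p : X i × X j => f (⟨i, p.1⟩, ⟨j, p.2⟩)) ⁻¹' s) := by
    ext ⟨⟨i, x⟩, ⟨j, y⟩⟩
    simp only [Set.mem_preimage, Set.mem_iUnion, Set.mem_image]
    constructor
    · exact fun hx => ⟨i, j, (x, y), hx, rfl⟩
    · rintro ⟨i', j', p, hp, he⟩
      rw [← he]
      exact hp
  rw [this]
  exact MeasurableSet.iUnion fun i => MeasurableSet.iUnion fun j =>
    ((measurableEmbedding_sigma_mk i).prodMap (measurableEmbedding_sigma_mk j)).measurableSet_image.2
      (h i j hs)

theorem measurableSet_sumRel [Countable ι] {E : ∀ i, X i → X i → Prop}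
    (hE : ∀ i, MeasurableSet {p : X i × X i | E i p.1 p.2}) :
    MeasurableSet {p : (Σ i, X i) × (Σ i, X i) | sumRel E p.1 p.2} := by
  have : {p : (Σ i, X i) × (Σ i, X i) | sumRel E p.1 p.2} =
      ⋃ i, Prod.map (Sigma.mk i) (Sigma.mk i) '' {p : X i × X i | E i p.1 p.2} := by
    ext ⟨a, b⟩
    simp only [Set.mem_ofPred_eq, Set.mem_iUnion, Set.mem_image]
    constructor
    · rintro ⟨i, x, y, h, rfl, rfl⟩
      exact ⟨i, (x, y), h, rfl⟩
    · rintro ⟨i, p, hp, he⟩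
      cases he
      exact sumRel_mk.2 hp
  rw [this]
  exact MeasurableSet.iUnion fun i =>
    ((measurableEmbedding_sigma_mk i).prodMap (measurableEmbedding_sigma_mk i)).measurableSet_image.2
      (hE i)

theorem BorelRed.to_sumRel (E : ∀ i, X i → X i → Prop) (i : ι) : BorelRed (E i) (sumRel E) :=
  ⟨Sigma.mk i, measurable_sigma_mk i, fun _ _ => sumRel_mk.symm⟩

theorem MultiBorelRed.to_sumRel {Y : ι → Type*} [∀ i, MeasurableSpace (Y i)]
    {E : ∀ i, X i → X i → Prop} {F : ∀ i, Y i → Y i → Prop}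
    (h : ∀ i, MultiBorelRed (E i) (F i)) : MultiBorelRed (sumRel E) (sumRel F) := by
  choose e he h1 h2 using h
  refine ⟨fun m a => ⟨a.1, e a.1 m a.2⟩, fun m => ?_, ?_, ?_⟩
  · exact measurable_sigma_iff.2 fun i => (measurable_sigma_mk i).comp (he i m)
  · rintro _ _ ⟨i, x, y, hxy, rfl, rfl⟩ m
    obtain ⟨m', hm'⟩ := h1 i x y hxy m
    exact ⟨m', sumRel_mk.2 hm'⟩
  · rintro ⟨i, x⟩ ⟨j, y⟩ m m' hxy
    obtain rfl : i = j := sumRel_fst hxy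
    exact sumRel_mk.2 (h2 i x y m m' (sumRel_mk.1 hxy))

theorem Doubling.to_sumRel {E : ∀ i, X i → X i → Prop} (h : ∀ i, Doubling (E i)) :
    Doubling (sumRel E) := by
  choose d hd hdr using h
  refine ⟨fun p => ⟨p.1.1, d p.1.1 (p.1.2, p.2)⟩, ?_, ?_⟩
  · refine measurable_from_prod_countable_left fun b => ?_
    exact measurable_sigma_iff.2 fun i =>
      (measurable_sigma_mk i).comp ((hd i).comp (measurable_id.prodMk measurable_const))
  · rintro ⟨⟨i, x⟩, b⟩ ⟨⟨j, y⟩, c⟩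
    by_cases hij : i = j
    · subst hij
      simp only [prodRel, sumRel_mk, ← hdr]
    · exact ⟨fun h => (hij (sumRel_fst h.1)).elim, fun h => (hij (sumRel_fst h)).elim⟩

theorem Pairing.to_sumRel [Countable ι] {E : ∀ i, X i → X i → Prop} (P : ι → Prop) (m : ι → ι → ι)
    (hm : ∀ i j, P (m i j)) (hl : ∀ i j, BorelRed (E i) (E (m i j)))
    (hr : ∀ i j, BorelRed (E j) (E (m i j))) (hp : ∀ k, P k → Pairing (E k))
    (hq : ∀ k, P k → CodesReals (E k)) : Pairing (sumRel E) := by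
  choose l hlm hlr using hl
  choose r hrm hrr using hr
  choose p hpm hpr using hp
  choose q hqm hqr using hq
  obtain ⟨code, hcode⟩ : ∃ c : ι × ι → (ℕ → Bool), Function.Injective c := by
    obtain ⟨c, hc⟩ := exists_injective_nat (ι × ι)
    refine ⟨fun i n => decide (n = c i), fun i j hij => hc ?_⟩
    have := congrFun hij (c i)
    simpa using this
  have inv : ∀ k k' (hk : P k) (hk' : P k') c c' (z : X k) (z' : X k'),
      sumRel E ⟨k, p k hk (q k hk c, z)⟩ ⟨k', p k' hk' (q k' hk' c', z')⟩ → c = c' := by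
    intro k k' hk hk' c c' z z' h
    obtain rfl : k = k' := sumRel_fst h
    exact (hqr k hk _ _).2 ((hpr k hk _ _).2 (sumRel_mk.1 h)).1
  refine ⟨fun a => ⟨m a.1.1 a.2.1, p _ (hm _ _)
    (q _ (hm _ _) (code (a.1.1, a.2.1)), p _ (hm _ _) (l _ _ a.1.2, r _ _ a.2.2))⟩, ?_, ?_⟩
  · refine measurable_sigma_prod fun i j => (measurable_sigma_mk (m i j)).comp ?_
    have hc : Measurable fun _ : X i × X j => q _ (hm i j) (code (i, j)) := measurable_const
    exact (hpm _ (hm i j)).comp (hc.prodMk ((hpm _ (hm i j)).comp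
      (((hlm i j).comp measurable_fst).prodMk ((hrm i j).comp measurable_snd))))
  · rintro ⟨⟨i, x⟩, ⟨j, y⟩⟩ ⟨⟨i', x'⟩, ⟨j', y'⟩⟩
    by_cases hij : (i, j) = (i', j')
    · cases hij
      simp only [prodRel, sumRel_mk, ← hpr, ← hqr, ← hlr, ← hrr, true_and]
    · constructor
      · rintro ⟨h1, h2⟩
        exact (hij (Prod.ext (sumRel_fst h1) (sumRel_fst h2))).elim
      · intro h
        exact (hij (hcode (inv _ _ _ _ _ _ _ _ h))).elim

end Sum

/-! ### The jump -/

section Jump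

variable {X Y : Type*} [MeasurableSpace X] [MeasurableSpace Y]

theorem gammaJump_equivalence {X : Type*} (Γ : Type*) [Group Γ] {E : X → X → Prop} (hE : Equivalence E) :
    Equivalence (GammaJump Γ E) := by
  refine ⟨fun x => ⟨1, fun a => by simpa using hE.refl _⟩, ?_, ?_⟩
  · rintro x y ⟨γ, h⟩
    refine ⟨γ⁻¹, fun a => hE.symm ?_⟩
    simpa using h (γ * a)
  · rintro x y z ⟨γ, h⟩ ⟨δ, h'⟩
    refine ⟨δ * γ, fun a => ?_⟩
    have := hE.trans (h (δ⁻¹ * a)) (h' a)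
    simpa [mul_assoc] using this

theorem measurableSet_gammaJump (Γ : Type*) [Group Γ] [Countable Γ] {E : X → X → Prop}
    (hE : MeasurableSet {p : X × X | E p.1 p.2}) :
    MeasurableSet {p : (Γ → X) × (Γ → X) | GammaJump Γ E p.1 p.2} := by
  have : {p : (Γ → X) × (Γ → X) | GammaJump Γ E p.1 p.2} =
      ⋃ γ : Γ, ⋂ a : Γ, (fun p : (Γ → X) × (Γ → X) => (p.1 (γ⁻¹ * a), p.2 a)) ⁻¹'
        {p : X × X | E p.1 p.2} := by
    ext p
    simp [GammaJump]
  rw [this]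
  exact MeasurableSet.iUnion fun γ => MeasurableSet.iInter fun a =>
    (((measurable_pi_apply _).comp measurable_fst).prodMk
      ((measurable_pi_apply _).comp measurable_snd)) hE

theorem multiBorelRed_gammaJump_eq (Γ : Type*) [Group Γ] [Countable Γ] :
    MultiBorelRed (GammaJump Γ (Eq : X → X → Prop)) (Eq : (Γ → X) → (Γ → X) → Prop) := by
  obtain ⟨s, hs⟩ := exists_surjective_nat Γ
  refine ⟨fun m x a => x (s m * a), fun m => measurable_pi_iff.2 fun a => measurable_pi_apply _,
    ?_, ?_⟩
  · rintro x y ⟨γ, h⟩ m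
    obtain ⟨m', hm'⟩ := hs (γ * s m)
    refine ⟨m', funext fun a => ?_⟩
    simp only [hm', ← h]
    simp [mul_assoc]
  · intro x y m m' h
    refine ⟨s m' * (s m)⁻¹, fun a => ?_⟩
    have := congrFun h ((s m')⁻¹ * a)
    simpa [mul_assoc] using this

/-- A relation on `ℤ` has a finite set of positions such that every shift preserving the relation
and moving each of these positions within its row moves every position within its row. -/
theorem exists_finite_window (r : ℤ → ℤ → Prop) (hr : ∀ i, r i i) :
    ∃ D : List ℤ, ∀ a : ℤ, (∀ i j, r (a + i) (a + j) ↔ r i j) → (∀ d ∈ D, r (a + d) d) →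
      ∀ n, r (a + n) n := by
  by_cases h : ∃ k : ℤ, 0 < k ∧ ∀ i j, r (k + i) (k + j) ↔ r i j
  · obtain ⟨k, hk, hkr⟩ := h
    have hmul : ∀ q i j : ℤ, r (k * q + i) (k * q + j) ↔ r i j := by
      intro q
      induction q using Int.induction_on with
      | zero => simp
      | succ n ih =>
        intro i j
        rw [← ih i j, ← hkr (k * n + i)]
        ring_nf
      | pred n ih =>
        intro i j
        rw [← ih i j, ← hkr (k * (-n - 1) + i)]
        ring_nf
    refine ⟨(List.range k.toNat).map (fun n : ℕ => (n : ℤ)), fun a _ hD n => ?_⟩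
    have h0 := Int.emod_nonneg n hk.ne'
    have h1 := Int.emod_lt_of_pos n hk
    have h2 : r (a + n % k) (n % k) := by
      apply hD
      simp only [List.mem_map, List.mem_range]
      exact ⟨(n % k).toNat, by omega, by omega⟩
    rw [← hmul (n / k)] at h2
    have h3 := Int.mul_ediv_add_emod n k
    rwa [show k * (n / k) + (a + n % k) = a + n by linarith, h3] at h2
  · push Not at h
    refine ⟨[], fun a ha _ n => ?_⟩
    have h1 : ¬ 0 < a := fun h0 => by
      obtain ⟨i, j, hij⟩ := h a h0
      rcases hij with hij | hij <;> simp [ha] at hij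
    have h2 : ¬ 0 < -a := fun h0 => by
      obtain ⟨i, j, hij⟩ := h (-a) h0
      have := ha (-a + i) (-a + j)
      simp only [add_neg_cancel_left] at this
      tauto
    obtain rfl : a = 0 := by omega
    simpa using hr n

/-- If a sequence of classes looks, on every finite window, like a shift of another sequence with
the same pattern of repetitions, then it is a shift of that sequence. -/
theorem exists_shift_of_forall_window {X : Type*} {E : X → X → Prop} (hE : Equivalence E) (x y : ℤ → X)
    (h : ∀ D : List ℤ, ∃ a : ℤ, (∀ i j, E (x i) (x j) ↔ E (y (a + i)) (y (a + j))) ∧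
      ∀ d ∈ D, E (x d) (y (a + d))) :
    ∃ a : ℤ, ∀ n, E (x n) (y (a + n)) := by
  obtain ⟨D, hD⟩ := exists_finite_window (fun i j => E (x i) (x j)) fun i => hE.refl _
  obtain ⟨a, ha, haD⟩ := h D
  refine ⟨a, fun n => ?_⟩
  obtain ⟨b, hb, hbD⟩ := h (n :: D)
  have key := hD (b - a) (fun i j => by
    rw [ha, hb, ← add_assoc, ← add_assoc, add_sub_cancel]) (fun d hd => by
      have h1 : E (x d) (y (a + (b - a + d))) := by
        rw [← add_assoc, add_sub_cancel]; exact hbD d (List.mem_cons_of_mem _ hd)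
      rw [ha]
      exact hE.trans (hE.symm h1) (haD d hd)) n
  rw [ha, ← add_assoc, add_sub_cancel] at key
  exact hE.trans (hbD n List.mem_cons_self) key

theorem gammaJump_int_iff {X : Type*} {E : X → X → Prop} (x y : Multiplicative ℤ → X) :
    GammaJump (Multiplicative ℤ) E x y ↔
      ∃ a : ℤ, ∀ n, E (x (.ofAdd n)) (y (.ofAdd (a + n))) := by
  constructor
  · rintro ⟨γ, h⟩
    refine ⟨γ.toAdd, fun n => ?_⟩
    have := h (γ * .ofAdd n)
    rwa [inv_mul_cancel_left] at this
  · rintro ⟨a, h⟩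
    refine ⟨.ofAdd a, fun n => ?_⟩
    have := h (-a + n.toAdd)
    rwa [add_neg_cancel_left] at this

/-- The main reduction of a `ℤ`-jump to a Friedman–Stanley jump. A sequence is sent to the set of
all triples consisting of the repetition pattern seen from some position, a finite list of
displacements, and the classes found there. -/
theorem borelRed_gammaJump_fsRel {E : X → X → Prop} {G : Y → Y → Prop} (hE : Equivalence E)
    (hG : Equivalence G) (hEm : MeasurableSet {p : X × X | E p.1 p.2}) (hEG : MultiBorelRed E G)
    (hp : Pairing G) (hq : CodesReals G) :
    BorelRed (GammaJump (Multiplicative ℤ) E) (fsRel G) := by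
  classical
  obtain ⟨e, hem, he1, he2⟩ := hEG
  obtain ⟨p, hpm, hpr⟩ := hp
  obtain ⟨q, hqm, hqr⟩ := hq
  have hp' : ∀ a b c d, G (p (a, b)) (p (c, d)) ↔ G a c ∧ G b d :=
    fun a b c d => (hpr (a, b) (c, d)).symm
  let ε := (Denumerable.eqv (ℤ × ℤ)).symm
  let pat : ℤ → (Multiplicative ℤ → X) → ℕ → Bool := fun a x n =>
    decide (E (x (.ofAdd (a + (ε n).1))) (x (.ofAdd (a + (ε n).2))))
  let code : List ℤ → ℕ → Bool := fun l n => decide (n = Encodable.encode l)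
  have hcode : ∀ l l', code l = code l' → l = l' := by
    intro l l' h
    have := congrFun h (Encodable.encode l)
    simpa [code] using this
  let word : ℤ → List (ℤ × ℕ) → (Multiplicative ℤ → X) → Y := fun a L x =>
    L.foldr (fun d z => p (e d.2 (x (.ofAdd (a + d.1))), z)) (q fun _ => false)
  let w : ℤ × List (ℤ × ℕ) → (Multiplicative ℤ → X) → Y := fun i x =>
    p (q (pat i.1 x), p (q (code (i.2.map Prod.fst)), word i.1 i.2 x))
  have hpat : ∀ a b x y, pat a x = pat b y ↔ ∀ i j, E (x (.ofAdd (a + i))) (x (.ofAdd (a + j))) ↔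
      E (y (.ofAdd (b + i))) (y (.ofAdd (b + j))) := by
    intro a b x y
    constructor
    · intro h i j
      have := congrFun h (ε.symm (i, j))
      simpa [pat] using this
    · intro h
      funext n
      simp only [pat, h]
  have hword : ∀ a b x y (L L' : List (ℤ × ℕ)), L.map Prod.fst = L'.map Prod.fst →
      G (word a L x) (word b L' y) → ∀ d ∈ L, E (x (.ofAdd (a + d.1))) (y (.ofAdd (b + d.1))) := by
    intro a b x y L
    induction L with
    | nil => simp
    | cons c L ih =>
      rintro (_ | ⟨c', L'⟩) hL h d hd
      · simp at hL
      · simp only [List.map_cons, List.cons.injEq] at hL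
        have h' := (hp' _ _ _ _).1 h
        rcases List.mem_cons.1 hd with rfl | hd
        · have := he2 _ _ _ _ h'.1
          rwa [← hL.1] at this
        · exact ih L' hL.2 h'.2 d hd
  have hword' : ∀ a b x y, (∀ n, E (x (.ofAdd (a + n))) (y (.ofAdd (b + n)))) →
      ∀ L : List (ℤ × ℕ), ∃ L' : List (ℤ × ℕ), L.map Prod.fst = L'.map Prod.fst ∧
        G (word a L x) (word b L' y) := by
    intro a b x y h L
    induction L with
    | nil => exact ⟨[], rfl, hG.refl _⟩
    | cons c L ih =>
      obtain ⟨L', h1, h2⟩ := ih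
      obtain ⟨m', hm'⟩ := he1 _ _ (h c.1) c.2
      refine ⟨(c.1, m') :: L', by simp [h1], ?_⟩
      exact (hp' _ _ _ _).2 ⟨hm', h2⟩
  have fwd : ∀ (x y : Multiplicative ℤ → X) (c : ℤ),
      (∀ n, E (x (.ofAdd n)) (y (.ofAdd (c + n)))) → ∀ i, ∃ j, G (w i x) (w j y) := by
    rintro x y c h ⟨a, L⟩
    have h' : ∀ n, E (x (.ofAdd (a + n))) (y (.ofAdd (c + a + n))) := fun n => by
      rw [add_assoc]; exact h _
    obtain ⟨L', h1, h2⟩ := hword' a (c + a) x y h' L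
    refine ⟨(c + a, L'), ?_⟩
    simp only [w, hp', ← hqr, h1, true_and]
    refine ⟨(hpat _ _ _ _).2 fun i j => ?_, h2⟩
    exact ⟨fun hij => hE.trans (hE.symm (h' i)) (hE.trans hij (h' j)),
      fun hij => hE.trans (h' i) (hE.trans hij (hE.symm (h' j)))⟩
  obtain ⟨φ, hφ⟩ := exists_surjective_nat (ℤ × List (ℤ × ℕ))
  refine ⟨fun x => (fun i => w i x) ∘ φ, ?_, fun x y => ?_⟩
  · have hwordm : ∀ a L, Measurable (word a L) := by
      intro a L
      induction L with
      | nil => exact measurable_const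
      | cons c L ih =>
        exact hpm.comp (((hem c.2).comp (measurable_pi_apply _)).prodMk ih)
    have hpatm : ∀ a, Measurable (pat a) := by
      intro a
      refine measurable_pi_iff.2 fun n => measurable_to_bool ?_
      have hm : Measurable fun x : Multiplicative ℤ → X =>
          (x (.ofAdd (a + (ε n).1)), x (.ofAdd (a + (ε n).2))) :=
        (measurable_pi_apply _).prodMk (measurable_pi_apply _)
      convert hm hEm using 1
      ext x
      simp [pat]
    refine measurable_pi_iff.2 fun n => ?_
    exact hpm.comp ((hqm.comp (hpatm _)).prodMk (hpm.comp (measurable_const.prodMk (hwordm _ _))))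
  · rw [fsRel_comp_iff hG hφ]
    constructor
    · intro h
      obtain ⟨c, hc⟩ := (gammaJump_int_iff x y).1 h
      obtain ⟨c', hc'⟩ := (gammaJump_int_iff y x).1 ((gammaJump_equivalence _ hE).symm h)
      exact ⟨fwd x y c hc, fun j => (fwd y x c' hc' j).imp fun _ h => hG.symm h⟩
    · rintro ⟨h, -⟩
      refine (gammaJump_int_iff x y).2 (exists_shift_of_forall_window hE
        (fun n => x (.ofAdd n)) (fun n => y (.ofAdd n)) fun D => ?_)
      obtain ⟨⟨b, L'⟩, hb⟩ := h (0, D.map fun d => (d, 0))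
      simp only [w, hp', ← hqr] at hb
      obtain ⟨h1, h2, h3⟩ := hb
      refine ⟨b, ?_, fun d hd => ?_⟩
      · simpa using (hpat _ _ _ _).1 h1
      · have := hword _ _ _ _ _ _ (hcode _ _ h2) h3 (d, 0) (List.mem_map_of_mem hd)
        simpa using this

end Jump

/-! ### The two hierarchies -/

instance BorelEqvRel.instMeasurableSpace (R : BorelEqvRel) : MeasurableSpace R.carrier := R.ms

theorem FStower_zero : FStower 0 = ⟨ULift ℕ, ⊤, Eq⟩ :=
  Ordinal.limitRecOn_zero ..

theorem FStower_add_one (o : Ordinal) : FStower (o + 1) = fsJumpB (FStower o) :=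
  Ordinal.limitRecOn_add_one ..

theorem FStower_limit {o : Ordinal} (ho : Order.IsSuccLimit o) :
    FStower o = fsJumpB (sumB fun i : {β : Ordinal // β < o} => FStower i.1) :=
  Ordinal.limitRecOn_limit _ _ _ _ ho

theorem Zrel_zero : Zrel 0 = deltaTwo := by
  unfold Zrel iterJump
  exact Ordinal.limitRecOn_zero ..

theorem Zrel_add_one (o : Ordinal) : Zrel (o + 1) = jumpB (Multiplicative ℤ) (Zrel o) := by
  unfold Zrel iterJump
  exact Ordinal.limitRecOn_add_one ..

theorem Zrel_limit {o : Ordinal} (ho : Order.IsSuccLimit o) :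
    Zrel o = jumpB (Multiplicative ℤ) (sumB fun i : {β : Ordinal // β < o} => Zrel i.1) := by
  unfold Zrel iterJump
  exact Ordinal.limitRecOn_limit _ _ _ _ ho

theorem FStower_equivalence (o : Ordinal) : Equivalence (FStower o).rel := by
  induction o using Ordinal.limitRecOn with
  | zero => rw [FStower_zero]; exact eq_equivalence
  | add_one o _ => rw [FStower_add_one]; exact fsRel_equivalence _
  | limit o ho _ => rw [FStower_limit ho]; exact fsRel_equivalence _

theorem FStower_doubling (o : Ordinal) : Doubling (FStower o).rel := by
  induction o using Ordinal.limitRecOn with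
  | zero =>
    rw [FStower_zero]
    let _ : MeasurableSpace (ULift ℕ) := ⊤
    have : Doubling (Eq : ULift ℕ → ULift ℕ → Prop) := by
      refine ⟨fun p => ⟨2 * p.1.down + p.2.toNat⟩, measurable_of_countable _, ?_⟩
      rintro ⟨⟨m⟩, b⟩ ⟨⟨n⟩, c⟩
      simp only [prodRel, ULift.up.injEq]
      constructor
      · rintro ⟨rfl, rfl⟩
        rfl
      · intro h
        have hb := Bool.toNat_le b
        have hc := Bool.toNat_le c
        exact ⟨by omega, bool_toNat_injective (by omega)⟩
    exact this
  | add_one o ih =>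
    rw [FStower_add_one]
    exact ih.to_fsRel (FStower_equivalence o)
  | limit o ho ih =>
    rw [FStower_limit ho]
    exact Doubling.to_fsRel (sumRel_equivalence fun i : {β : Ordinal // β < o} =>
      FStower_equivalence i.1) (Doubling.to_sumRel fun i => ih i.1 i.2)

theorem FStower_pairing {o : Ordinal} (h : 1 ≤ o) : Pairing (FStower o).rel := by
  induction o using Ordinal.limitRecOn with
  | zero => simp at h
  | add_one o _ =>
    rw [FStower_add_one]
    exact Doubling.pairing_fsRel (FStower_equivalence o) (FStower_doubling o)
  | limit o ho _ =>
    rw [FStower_limit ho]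
    exact Doubling.pairing_fsRel (sumRel_equivalence fun i : {β : Ordinal // β < o} =>
      FStower_equivalence i.1) (Doubling.to_sumRel fun i => FStower_doubling i.1)

theorem borelRed_FStower_limit {o : Ordinal} (ho : Order.IsSuccLimit o) {β : Ordinal}
    (hβ : β < o) : BorelRed (FStower β).rel (FStower o).rel := by
  rw [FStower_limit ho]
  exact (BorelRed.to_sumRel (fun i : {β : Ordinal // β < o} => (FStower i.1).rel) ⟨β, hβ⟩).trans
    (BorelRed.to_fsRel (sumRel_equivalence fun i => FStower_equivalence i.1))

theorem FStower_mono {β o : Ordinal} (h : β ≤ o) : BorelRed (FStower β).rel (FStower o).rel := by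
  induction o using Ordinal.limitRecOn with
  | zero =>
    obtain rfl : β = 0 := by simpa using h
    exact BorelRed.refl _
  | add_one o ih =>
    rcases h.eq_or_lt with rfl | h
    · exact BorelRed.refl _
    · refine (ih (Order.lt_add_one_iff.1 h)).trans ?_
      rw [FStower_add_one]
      exact BorelRed.to_fsRel (FStower_equivalence o)
  | limit o ho _ =>
    rcases h.eq_or_lt with rfl | h
    · exact BorelRed.refl _
    · exact borelRed_FStower_limit ho h

theorem FStower_codesReals {o : Ordinal} (h : 1 ≤ o) : CodesReals (FStower o).rel := by
  refine BorelRed.trans ?_ (FStower_mono h)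
  rw [← zero_add (1 : Ordinal), FStower_add_one, FStower_zero]
  exact codesReals_fsRel_eq

theorem countable_subtype_lt_of_card_le {o : Ordinal.{0}} (h : o.card ≤ Cardinal.aleph0) :
    Countable {β : Ordinal // β < o} := by
  rw [← Cardinal.mk_le_aleph0_iff]
  have := Cardinal.mk_Iio_ordinal o
  exact this.trans_le (Cardinal.lift_le_aleph0.2 h)

theorem Zrel_equivalence (o : Ordinal) : Equivalence (Zrel o).rel := by
  induction o using Ordinal.limitRecOn with
  | zero => rw [Zrel_zero]; exact eq_equivalence
  | add_one o ih =>
    rw [Zrel_add_one]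
    exact gammaJump_equivalence _ ih
  | limit o ho ih =>
    rw [Zrel_limit ho]
    exact gammaJump_equivalence _
      (sumRel_equivalence fun i : {β : Ordinal // β < o} => ih i.1 i.2)

theorem measurableSet_Zrel {o : Ordinal} (h : o.card ≤ Cardinal.aleph0) :
    MeasurableSet {p : (Zrel o).carrier × (Zrel o).carrier | (Zrel o).rel p.1 p.2} := by
  induction o using Ordinal.limitRecOn with
  | zero =>
    rw [Zrel_zero]
    have : MeasurableSet {p : ULift Bool × ULift Bool | p.1 = p.2} :=
      measurableSet_eq_fun measurable_fst measurable_snd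
    exact this
  | add_one o ih =>
    rw [Zrel_add_one]
    exact measurableSet_gammaJump _ (ih ((Ordinal.card_le_card le_self_add).trans h))
  | limit o ho ih =>
    rw [Zrel_limit ho]
    have := countable_subtype_lt_of_card_le h
    exact measurableSet_gammaJump _ (measurableSet_sumRel fun i : {β : Ordinal // β < o} =>
      ih i.1 i.2 ((Ordinal.card_le_card i.2.le).trans h))

theorem sumB_FStower_pairing {o : Ordinal} (ho : Order.IsSuccLimit o)
    (h : o.card ≤ Cardinal.aleph0) :
    Pairing (sumB fun i : {β : Ordinal // β < o} => FStower i.1).rel := by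
  have := countable_subtype_lt_of_card_le h
  have h1 : 1 < o := by
    have := ho.add_one_lt ho.bot_lt
    simpa using this
  exact Pairing.to_sumRel (E := fun i : {β : Ordinal // β < o} => (FStower i.1).rel)
    (fun i => 1 ≤ i.1)
    (fun i j => ⟨max (max i.1 j.1) 1, max_lt (max_lt i.2 j.2) h1⟩)
    (fun i j => le_max_right _ _)
    (fun i j => FStower_mono ((le_max_left _ _).trans (le_max_left _ _)))
    (fun i j => FStower_mono ((le_max_right _ _).trans (le_max_left _ _)))
    (fun k hk => FStower_pairing hk) (fun k hk => FStower_codesReals hk)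

theorem sumB_FStower_codesReals {o : Ordinal} (ho : Order.IsSuccLimit o) :
    CodesReals (sumB fun i : {β : Ordinal // β < o} => FStower i.1).rel := by
  have h1 : 1 < o := by
    have := ho.add_one_lt ho.bot_lt
    simpa using this
  exact (FStower_codesReals le_rfl).trans
    (BorelRed.to_sumRel (fun i : {β : Ordinal // β < o} => (FStower i.1).rel) ⟨1, h1⟩)

theorem Zrel_zero_multiBorelRed : MultiBorelRed (Zrel 0).rel (FStower 0).rel := by
  rw [Zrel_zero, FStower_zero]
  let _ : MeasurableSpace (ULift ℕ) := ⊤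
  let _ : MeasurableSpace (ULift Bool) := ⊤
  have : BorelRed (Eq : ULift Bool → ULift Bool → Prop) (Eq : ULift ℕ → ULift ℕ → Prop) := by
    refine ⟨fun b => ⟨b.down.toNat⟩, measurable_from_top, ?_⟩
    rintro ⟨b⟩ ⟨c⟩
    simp [bool_toNat_injective.eq_iff]
  exact this.multi

theorem Zrel_one_multiBorelRed : MultiBorelRed (Zrel 1).rel (FStower 1).rel := by
  have h : MultiBorelRed (Zrel 1).rel
      (Eq : (Multiplicative ℤ → ULift Bool) → (Multiplicative ℤ → ULift Bool) → Prop) := by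
    rw [← zero_add (1 : Ordinal), Zrel_add_one, Zrel_zero]
    exact multiBorelRed_gammaJump_eq _
  refine (h.trans ?_).trans (FStower_codesReals le_rfl)
  obtain ⟨s, hs⟩ := exists_surjective_nat (Multiplicative ℤ)
  refine ⟨fun x n => (x (s n)).down, ?_, fun x y => ?_⟩
  · exact measurable_pi_iff.2 fun n => measurable_down.comp (measurable_pi_apply _)
  · constructor
    · rintro rfl
      rfl
    · intro h
      funext a
      obtain ⟨n, rfl⟩ := hs a
      exact ULift.down_injective (congrFun h n)

theorem Zrel_borelRed_of_forall_lt {o : Ordinal} (h2 : 2 ≤ o) (h : o.card ≤ Cardinal.aleph0)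
    (ih : ∀ β < o, MultiBorelRed (Zrel β).rel (FStower β).rel) :
    BorelRed (Zrel o).rel (FStower o).rel := by
  have hc : ∀ β < o, β.card ≤ Cardinal.aleph0 := fun β hβ => (Ordinal.card_le_card hβ.le).trans h
  induction o using Ordinal.limitRecOn with
  | zero => simp at h2
  | add_one o _ =>
    have h1 : 1 ≤ o := by
      rw [← one_add_one_eq_two] at h2
      exact Order.lt_add_one_iff.1 (Order.add_one_le_iff.1 h2)
    have ho : o < o + 1 := Order.lt_add_one_iff.2 le_rfl
    rw [Zrel_add_one, FStower_add_one]
    exact borelRed_gammaJump_fsRel (Zrel_equivalence o) (FStower_equivalence o)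
      (measurableSet_Zrel (hc o ho)) (ih o ho) (FStower_pairing h1) (FStower_codesReals h1)
  | limit o ho _ =>
    have := countable_subtype_lt_of_card_le h
    rw [Zrel_limit ho, FStower_limit ho]
    exact borelRed_gammaJump_fsRel
      (sumRel_equivalence fun i : {β : Ordinal // β < o} => Zrel_equivalence i.1)
      (sumRel_equivalence fun i : {β : Ordinal // β < o} => FStower_equivalence i.1)
      (measurableSet_sumRel fun i => measurableSet_Zrel (hc i.1 i.2))
      (MultiBorelRed.to_sumRel fun i => ih i.1 i.2)
      (sumB_FStower_pairing ho h) (sumB_FStower_codesReals ho)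

theorem Zrel_multiBorelRed_FStower (o : Ordinal) (h : o.card ≤ Cardinal.aleph0) :
    MultiBorelRed (Zrel o).rel (FStower o).rel := by
  induction o using WellFoundedLT.induction with
  | ind o ih =>
    rcases lt_or_ge o 2 with ho | ho
    · rw [← one_add_one_eq_two, Order.lt_add_one_iff, Order.le_one_iff] at ho
      rcases ho with rfl | rfl
      · exact Zrel_zero_multiBorelRed
      · exact Zrel_one_multiBorelRed
    · exact (Zrel_borelRed_of_forall_lt ho h fun β hβ =>
        ih β hβ ((Ordinal.card_le_card hβ.le).trans h)).multi

/-- For every countable ordinal `α ≥ 2`, `Z_α` is Borel reducible to the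
Friedman–Stanley iterate `F_α`. -/
theorem Zrel_borelReducible_FStower (α : Ordinal) (h2 : 2 ≤ α)
    (hcount : α.card ≤ Cardinal.aleph0) :
    RedB (Zrel α) (FStower α) := by
  exact Zrel_borelRed_of_forall_lt h2 hcount fun β hβ =>
    Zrel_multiBorelRed_FStower β ((Ordinal.card_le_card hβ.le).trans hcount)
end

section
/- Let Γ be a countable group such that ℤ or ⊕_{n∈ℕ} ℤ/pℤ for some prime p is a quotient of a subgroup of Γ (i.e., some subgroup of Γ admits a surjective group homomorphism onto ℤ or onto the direct sum of countably many copies of ℤ/pℤ for some prime p). Then for every Borel equivalence relation E on a standard Borel space with at least two equivalence classes, E is Borel reducible to E^{[Γ]} but E^{[Γ]} is not Borel reducible to E; that is, E <_B E^{[Γ]}. -/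
/-- Borel reducibility of binary relations on measurable spaces. -/
def BorelReducible {X Y : Type*} [MeasurableSpace X] [MeasurableSpace Y]
    (E : X → X → Prop) (F : Y → Y → Prop) : Prop :=
  ∃ f : X → Y, Measurable f ∧ ∀ x x', E x x' ↔ F (f x) (f x')

namespace GammaJump

open MeasureTheory Topology TopologicalSpace Set

section Absorption

variable {X : Type*} [MeasurableSpace X] {E : X → X → Prop}

/-- The constant sequences reduce `E` to its jump. -/
theorem borelReducible_gammaJump (Γ : Type*) [Group Γ] (E : X → X → Prop) :
    BorelReducible E (GammaJump Γ E) :=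
  ⟨fun x _ => x, measurable_pi_lambda _ fun _ => measurable_id,
    fun _ _ => ⟨fun h => ⟨1, fun _ => h⟩, fun ⟨_, h⟩ => h 1⟩⟩

/-- A Borel self-reduction of `E` whose saturated range omits a class. -/
def HasSpareClass (E : X → X → Prop) : Prop :=
  ∃ (u : X → X) (v : X), Measurable u ∧ (∀ x y, E x y ↔ E (u x) (u y)) ∧ ∀ x, ¬ E (u x) v

theorem hasSpareClass {Γ : Type*} [Group Γ] [Nontrivial Γ] (hE : Equivalence E)
    (htwo : ∃ a b : X, ¬ E a b) (hJ : BorelReducible (GammaJump Γ E) E) :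
    HasSpareClass E := by
  classical
  obtain ⟨f, hf, hfE⟩ := hJ
  obtain ⟨a, b, hab⟩ := htwo
  obtain ⟨c, hc, hcE⟩ := borelReducible_gammaJump Γ E
  refine ⟨fun x => f fun _ => x, f fun γ => if γ = 1 then a else b,
    hf.comp (measurable_pi_lambda _ fun _ => measurable_id), fun x y => ?_, fun x hx => ?_⟩
  · rw [← hfE]
    exact ⟨fun h => ⟨1, fun _ => h⟩, fun ⟨_, h⟩ => h 1⟩
  · rw [← hfE] at hx
    obtain ⟨_, h⟩ := hx
    obtain ⟨γ, hγ⟩ := exists_ne (1 : Γ)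
    have h1 := h 1
    have h2 := h γ
    simp only [if_true, if_neg hγ] at h1 h2
    exact hab (hE.trans (hE.symm h1) h2)

theorem absorbs_of_injective {Γ Λ : Type*} [Group Γ] [Group Λ]
    (hE : Equivalence E) (hS : HasSpareClass E) (i : Λ →* Γ) (hi : Function.Injective i)
    (hJ : BorelReducible (GammaJump Γ E) E) : BorelReducible (GammaJump Λ E) E := by
  classical
  obtain ⟨f, hf, hfE⟩ := hJ
  obtain ⟨u, v, hu, huE, huv⟩ := hS
  let e : (Λ → X) → Γ → X := fun x γ =>
    if h : ∃ l, i l = γ then u (x h.choose) else v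
  have e_in (x : Λ → X) (l : Λ) : e x (i l) = u (x l) := by
    have h : ∃ l', i l' = i l := ⟨l, rfl⟩
    simp only [e, dif_pos h, hi h.choose_spec]
  have e_out (x : Λ → X) (γ : Γ) (h : ¬ ∃ l, i l = γ) : e x γ = v := dif_neg h
  refine ⟨fun x => f (e x), hf.comp (measurable_pi_lambda _ fun γ => ?_), fun x y => ?_⟩
  · by_cases h : ∃ l, i l = γ
    · simp only [e, dif_pos h]
      exact hu.comp (measurable_pi_apply _)
    · simp only [e, dif_neg h]
      exact measurable_const
  rw [← hfE]
  constructor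
  · rintro ⟨l, hl⟩
    refine ⟨i l, fun α => ?_⟩
    by_cases h : ∃ l', i l' = α
    · obtain ⟨l', rfl⟩ := h
      rw [← map_inv, ← map_mul, e_in, e_in, ← huE]
      exact hl l'
    · rw [e_out _ α h, e_out]
      · exact hE.refl v
      · rintro ⟨l', hl'⟩
        exact h ⟨l * l', by rw [map_mul, hl', mul_inv_cancel_left]⟩
  · rintro ⟨γ, hγ⟩
    have hr : ∃ l, i l = γ := by
      by_contra h
      have := hγ γ
      rw [e_out y γ h, inv_mul_cancel, ← map_one i, e_in] at this
      exact huv _ this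
    obtain ⟨l, rfl⟩ := hr
    refine ⟨l, fun α => ?_⟩
    have := hγ (i α)
    rwa [← map_inv, ← map_mul, e_in, e_in, ← huE] at this

theorem absorbs_of_surjective {Γ Q : Type*} [Group Γ] [Group Q] (π : Γ →* Q)
    (hπ : Function.Surjective π) (hJ : BorelReducible (GammaJump Γ E) E) :
    BorelReducible (GammaJump Q E) E := by
  obtain ⟨f, hf, hfE⟩ := hJ
  refine ⟨fun x => f (x ∘ π), hf.comp (measurable_pi_lambda _ fun γ => measurable_pi_apply _),
    fun x y => ?_⟩
  rw [← hfE]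
  constructor
  · rintro ⟨q, hq⟩
    obtain ⟨γ, rfl⟩ := hπ q
    exact ⟨γ, fun α => by simpa using hq (π α)⟩
  · rintro ⟨γ, hγ⟩
    refine ⟨π γ, fun q => ?_⟩
    obtain ⟨α, rfl⟩ := hπ q
    simpa using hγ α

/-- If `E` absorbs the jump of an infinite group, then it absorbs its countable power. -/
theorem absorbs_power {Γ : Type*} [Group Γ] [Infinite Γ]
    (hS : HasSpareClass E) (hE : Equivalence E) (hJ : BorelReducible (GammaJump Γ E) E) :
    BorelReducible (fun x y : ℕ → X => ∀ s, E (x s) (y s)) E := by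
  classical
  obtain ⟨f, hf, hfE⟩ := hJ
  obtain ⟨u, v, hu, huE, huv⟩ := hS
  have : Infinite ({1}ᶜ : Set Γ) := (Set.finite_singleton (1 : Γ)).infinite_compl.to_subtype
  let j := Infinite.natEmbedding ({1}ᶜ : Set Γ)
  let s : Γ → ℕ := Function.invFun fun n => (j n : Γ)
  have hs (n : ℕ) : s (j n) = n :=
    Function.leftInverse_invFun (Subtype.val_injective.comp j.injective) n
  let e : (ℕ → X) → Γ → X := fun x γ => if γ = 1 then v else u (x (s γ))
  refine ⟨fun x => f (e x), hf.comp (measurable_pi_lambda _ fun γ => ?_), fun x y => ?_⟩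
  · by_cases h : γ = 1
    · simp only [e, if_pos h]
      exact measurable_const
    · simp only [e, if_neg h]
      exact hu.comp (measurable_pi_apply _)
  rw [← hfE]
  constructor
  · intro h
    refine ⟨1, fun α => ?_⟩
    rw [inv_one, one_mul]
    by_cases hα : α = 1
    · simp only [e, if_pos hα]
      exact hE.refl v
    · simp only [e, if_neg hα]
      exact (huE _ _).1 (h _)
  · rintro ⟨γ, hγ⟩ n
    obtain rfl : γ = 1 := by
      by_contra h
      have := hγ 1
      simp only [e, mul_one, inv_eq_one, if_neg h, if_true] at this
      exact huv _ this
    have := hγ (j n)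
    have hj : (j n : Γ) ≠ 1 := (j n).2
    simp only [e, inv_one, one_mul, if_neg hj, hs] at this
    exact (huE _ _).2 this

theorem exists_inequivalent_seq (hE : Equivalence E) (htwo : ∃ a b : X, ¬ E a b)
    (hP : BorelReducible (fun x y : ℕ → X => ∀ s, E (x s) (y s)) E) :
    ∃ v : ℕ → X, ∀ i j, E (v i) (v j) ↔ i = j := by
  obtain ⟨f, -, hfE⟩ := hP
  obtain ⟨a, b, hab⟩ := htwo
  refine ⟨fun i => f fun s => if s = i then a else b, fun i j => ?_⟩
  rw [← hfE]
  refine ⟨fun h => by_contra fun hij => hab ?_, ?_⟩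
  · simpa [hij] using h i
  · rintro rfl s
    exact hE.refl _

end Absorption

section Coding

variable {X : Type*} [MeasurableSpace X]

/-- A coding of a function `φ` from Cantor space to an abelian group `A`: a Polish abelian group
`G` with a partial homomorphism to `A`, given by its graph, whose kernel has a coset equivalence
relation Borel reducible to `E` via `ρ`, and a continuous map through which `φ` factors. -/
structure Coding (E : X → X → Prop) {A : Type} [AddCommGroup A] (φ : (ℕ → Bool) → A) where
  G : Type
  [group : AddCommGroup G]
  [top : TopologicalSpace G]
  [topGroup : IsTopologicalAddGroup G]
  [polish : PolishSpace G]
  [meas : MeasurableSpace G]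
  [borel : BorelSpace G]
  graph : AddSubgroup (G × A)
  ρ : G → X
  θ : (ℕ → Bool) → G
  exists_mem : ∀ a, ∃ x, (x, a) ∈ graph
  eq_zero : ∀ a, (0, a) ∈ graph → a = 0
  measurable_ρ : Measurable ρ
  rel_iff : ∀ x y, E (ρ x) (ρ y) ↔ (x - y, 0) ∈ graph
  continuous_θ : Continuous θ
  mem_graph : ∀ z, (θ z, φ z) ∈ graph

attribute [instance] Coding.group Coding.top Coding.topGroup Coding.polish Coding.meas
  Coding.borel

variable {E : X → X → Prop}

/-- Codings of functions `φ s` that factor through a common function `h` into a group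
`Λ` yield a coding of `τ ∘ h`, as long as `E` absorbs the jump of the kernel of `τ`. -/
theorem nonempty_coding_comp {Λ A : Type} {F : ℕ → Type} [AddCommGroup Λ]
    [AddCommGroup A] [∀ s, AddCommGroup (F s)] (e : ∀ s, Λ →+ F s) (τ : Λ →+ A)
    (hτ : Function.Surjective τ) (he : ∀ l, (∀ s, e s l = 0) → τ l = 0)
    (hP : BorelReducible (fun x y : ℕ → X => ∀ s, E (x s) (y s)) E)
    (hJ : BorelReducible (GammaJump (Multiplicative τ.ker) E) E)
    (h : (ℕ → Bool) → Λ) (C : ∀ s, Nonempty (Coding E fun z => e s (h z))) :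
    Nonempty (Coding E fun z => τ (h z)) := by
  classical
  replace C := fun s => (C s).some
  obtain ⟨f, hf, hfE⟩ := hP
  obtain ⟨k, hk, hkE⟩ := hJ
  choose w hw using fun (s : ℕ) (l : Λ) => (C s).exists_mem (e s l)
  let r : (∀ s, (C s).G) → Multiplicative τ.ker → X := fun x l =>
    f fun s => (C s).ρ (x s + w s l.toAdd)
  refine ⟨{
    G := ∀ s, (C s).G
    graph :=
      { carrier := {p | ∃ l, τ l = p.2 ∧ ∀ s, (p.1 s, e s l) ∈ (C s).graph}
        add_mem' := ?_
        zero_mem' := ⟨0, by simp, fun s => by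
          rw [map_zero]
          exact (C s).graph.zero_mem⟩
        neg_mem' := ?_ }
    ρ := fun x => k (r x)
    θ := fun z s => (C s).θ z
    exists_mem := fun a => ?_
    eq_zero := ?_
    measurable_ρ := ?_
    rel_iff := fun x y => ?_
    continuous_θ := continuous_pi fun s => (C s).continuous_θ
    mem_graph := fun z => ⟨h z, rfl, fun s => (C s).mem_graph z⟩ }⟩
  · rintro p q ⟨l, hl, hl'⟩ ⟨m, hm, hm'⟩
    exact ⟨l + m, by simp [hl, hm], fun s => by simpa using (C s).graph.add_mem (hl' s) (hm' s)⟩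
  · rintro p ⟨l, hl, hl'⟩
    exact ⟨-l, by simp [hl], fun s => by simpa using (C s).graph.neg_mem (hl' s)⟩
  · obtain ⟨l, rfl⟩ := hτ a
    exact ⟨fun s => w s l, l, rfl, fun s => hw s l⟩
  · rintro a ⟨l, rfl, hl⟩
    exact he l fun s => (C s).eq_zero _ (hl s)
  · refine hk.comp (measurable_pi_lambda _ fun l => hf.comp (measurable_pi_lambda _ fun s => ?_))
    exact (C s).measurable_ρ.comp ((measurable_pi_apply s).add_const _)
  · have key (l₀ l : τ.ker) (s : ℕ) :
        E ((C s).ρ (x s + w s (-l₀ + l : τ.ker))) ((C s).ρ (y s + w s l)) ↔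
          (x s - y s, e s l₀) ∈ (C s).graph := by
      rw [(C s).rel_iff]
      have hd : (w s (-l₀ + l : τ.ker) - w s l, -e s l₀) ∈ (C s).graph := by
        simpa using (C s).graph.sub_mem (hw s (-l₀ + l : τ.ker)) (hw s l)
      rw [← (C s).graph.add_mem_cancel_right hd (y := (x s - y s, e s l₀)), Prod.mk_add_mk,
        add_neg_cancel, ← add_sub_add_comm]
    rw [← hkE]
    constructor
    · rintro ⟨l₀, hl₀⟩
      refine ⟨l₀.toAdd, l₀.toAdd.2, fun s => ?_⟩
      exact (key l₀.toAdd 0 s).1 ((hfE _ _).2 (hl₀ 1) s)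
    · rintro ⟨l₀, hl₀, hmem⟩
      refine ⟨Multiplicative.ofAdd ⟨l₀, hl₀⟩, fun l => (hfE _ _).1 fun s => ?_⟩
      exact (key ⟨l₀, hl₀⟩ l.toAdd s).2 (hmem s)

theorem nonempty_coding_add {A : Type} [AddCommGroup A]
    (hP : BorelReducible (fun x y : ℕ → X => ∀ s, E (x s) (y s)) E)
    (hJ : BorelReducible (GammaJump (Multiplicative A) E) E) {φ ψ : (ℕ → Bool) → A}
    (hφ : Nonempty (Coding E φ)) (hψ : Nonempty (Coding E ψ)) :
    Nonempty (Coding E (φ + ψ)) := by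
  let e : ℕ → A × A →+ A := fun s => if s = 0 then .fst A A else .snd A A
  let τ : A × A →+ A := AddMonoidHom.fst A A + AddMonoidHom.snd A A
  have hτ (l) : l ∈ τ.ker ↔ l.1 + l.2 = 0 := Iff.rfl
  let i : A →+ τ.ker := (AddMonoidHom.prod (.id A) (-.id A)).codRestrict τ.ker fun a => by
    simp [hτ]
  refine nonempty_coding_comp e τ (fun a => ⟨(a, 0), by simp [τ]⟩) (fun l hl => ?_) hP
    (absorbs_of_surjective i.toMultiplicative ?_ hJ) (fun z => (φ z, ψ z)) fun s => ?_
  · have h0 := hl 0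
    have h1 := hl 1
    simp only [e] at h0 h1
    simp_all [τ]
  · rintro ⟨⟨a, b⟩, hab⟩
    refine ⟨Multiplicative.ofAdd a, ?_⟩
    have : -a = b := neg_eq_of_add_eq_zero_right hab
    subst this
    rfl
  · by_cases hs : s = 0
    · simp only [e, if_pos hs]
      exact hφ
    · simp only [e, if_neg hs]
      exact hψ

theorem nonempty_coding_clopen (hE : Equivalence E) (htwo : ∃ a b : X, ¬ E a b)
    (hP : BorelReducible (fun x y : ℕ → X => ∀ s, E (x s) (y s)) E) (m : ℕ) [NeZero m]
    (a : ZMod m) {D : Set (ℕ → Bool)} (hD : IsClopen D) :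
    Nonempty (Coding E (D.indicator fun _ => a)) := by
  classical
  obtain ⟨v, hv⟩ := exists_inequivalent_seq hE htwo hP
  refine ⟨{
    G := ℤ
    graph := (Int.castAddHom (ZMod m)).graph
    ρ := fun n => v (n : ZMod m).val
    θ := D.indicator fun _ => a.val
    exists_mem := fun b => ⟨b.val, by simp [AddMonoidHom.mem_graph]⟩
    eq_zero := fun b hb => by simpa [AddMonoidHom.mem_graph] using hb.symm
    measurable_ρ := measurable_from_top
    rel_iff := fun x y => ?_
    continuous_θ := (continuous_const).indicator (by simp [hD.frontier_eq])
    mem_graph := fun z => ?_ }⟩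
  · rw [hv, (ZMod.val_injective m).eq_iff]
    simp [AddMonoidHom.mem_graph, sub_eq_zero]
  · by_cases hz : z ∈ D <;> simp [AddMonoidHom.mem_graph, hz]

/-- `D` has coded indicator functions with values in `ZMod m`, for all `m ∈ I`. -/
def CodedSet (E : X → X → Prop) (I : Set ℕ) (D : Set (ℕ → Bool)) : Prop :=
  ∀ m ∈ I, ∀ a : ZMod m, Nonempty (Coding E (D.indicator fun _ => a))

theorem codedSet_of_measurableSet (hE : Equivalence E) (htwo : ∃ a b : X, ¬ E a b)
    (hP : BorelReducible (fun x y : ℕ → X => ∀ s, E (x s) (y s)) E) {I : Set ℕ}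
    (hI : ∀ m ∈ I, m ≠ 0)
    (hJ : ∀ m ∈ I, BorelReducible (GammaJump (Multiplicative (ZMod m)) E) E)
    (hU : ∀ D : ℕ → Set (ℕ → Bool), Pairwise (Function.onFun Disjoint D) →
      (∀ n, CodedSet E I (D n)) → CodedSet E I (⋃ n, D n))
    {D : Set (ℕ → Bool)} (hD : MeasurableSet D) : CodedSet E I D := by
  have hclopen {D : Set (ℕ → Bool)} (hD : IsClopen D) : CodedSet E I D := fun m hm a =>
    have : NeZero m := ⟨hI m hm⟩
    nonempty_coding_clopen hE htwo hP m a hD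
  have hgen : (inferInstance : MeasurableSpace (ℕ → Bool)) =
      .generateFrom {s : Set (ℕ → Bool) | IsClopen s} := by
    rw [← isTopologicalBasis_isClopen.borel_eq_generateFrom]
    exact BorelSpace.measurable_eq
  induction D, hD using MeasurableSpace.induction_on_inter hgen
    (fun s hs t ht _ => IsClopen.inter hs ht) with
  | empty => exact hclopen isClopen_empty
  | basic t ht => exact hclopen ht
  | compl t _ ih =>
    intro m hm a
    have : NeZero m := ⟨hI m hm⟩
    convert nonempty_coding_add hP (hJ m hm) (hclopen isClopen_univ m hm a) (ih m hm (-a)) using 2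
    ext z
    by_cases hz : z ∈ t <;> simp [hz]
  | iUnion t hd _ ih => exact hU t hd ih

theorem codedSet_iUnion_singleton {p : ℕ}
    (hP : BorelReducible (fun x y : ℕ → X => ∀ s, E (x s) (y s)) E) (hS : HasSpareClass E)
    (hE : Equivalence E)
    (hJ : BorelReducible (GammaJump (Multiplicative (ℕ →₀ ZMod p)) E) E)
    (D : ℕ → Set (ℕ → Bool)) (hd : Pairwise (Function.onFun Disjoint D))
    (hD : ∀ n, CodedSet E {p} (D n)) : CodedSet E {p} (⋃ n, D n) := by
  classical
  rintro m rfl a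
  let τ : (ℕ →₀ ZMod m) →+ ZMod m := Finsupp.liftAddHom fun _ => .id _
  have hτ (n a) : τ (.single n a) = a := by simp [τ]
  have hJ' := absorbs_of_injective hE hS (τ.ker.subtype.toMultiplicative)
    (fun _ _ h => Subtype.ext h) hJ
  let h : (ℕ → Bool) → ℕ →₀ ZMod m := fun z =>
    if hz : ∃ n, z ∈ D n then .single hz.choose a else 0
  have h_in {z n} (hz : z ∈ D n) : h z = .single n a := by
    have hz' : ∃ n, z ∈ D n := ⟨n, hz⟩
    have : hz'.choose = n := by
      by_contra hne
      exact (hd hne).le_bot ⟨hz'.choose_spec, hz⟩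
    simp only [h, dif_pos hz', this]
  have h_out {z} (hz : ¬ ∃ n, z ∈ D n) : h z = 0 := dif_neg hz
  convert nonempty_coding_comp (E := E) (fun s => Finsupp.applyAddHom s) τ
    (fun b => ⟨.single 0 b, hτ 0 b⟩) (fun l hl => ?_) hP hJ' h fun s => ?_ using 2
  · ext z
    by_cases hz : ∃ n, z ∈ D n
    · obtain ⟨n, hn⟩ := hz
      rw [h_in hn, hτ, indicator_of_mem (mem_iUnion.2 ⟨n, hn⟩)]
    · rw [h_out hz, map_zero, indicator_of_notMem (by simpa using hz)]
  · rw [show l = 0 from Finsupp.ext hl, map_zero]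
  · convert hD s m rfl a using 2
    ext z
    by_cases hz : ∃ n, z ∈ D n
    · obtain ⟨n, hn⟩ := hz
      rw [h_in hn]
      by_cases hs : n = s
      · subst hs
        simp [hn]
      · have : z ∉ D s := fun h' => (hd hs).le_bot ⟨hn, h'⟩
        simp [this, hs]
    · rw [h_out hz, indicator_of_notMem fun h' => hz ⟨s, h'⟩, map_zero]

theorem codedSet_iUnion_int
    (hP : BorelReducible (fun x y : ℕ → X => ∀ s, E (x s) (y s)) E) (hS : HasSpareClass E)
    (hE : Equivalence E) (hJ : BorelReducible (GammaJump (Multiplicative ℤ) E) E)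
    (hJm : ∀ m, m ≠ 0 → BorelReducible (GammaJump (Multiplicative (ZMod m)) E) E)
    (D : ℕ → Set (ℕ → Bool)) (hd : Pairwise (Function.onFun Disjoint D))
    (hD : ∀ n, CodedSet E {m | m ≠ 0} (D n)) : CodedSet E {m | m ≠ 0} (⋃ n, D n) := by
  classical
  intro m hm a
  have : NeZero m := ⟨hm⟩
  let τ : ℤ →+ ZMod m := Int.castAddHom (ZMod m)
  have hJ' := absorbs_of_injective hE hS (τ.ker.subtype.toMultiplicative)
    (fun _ _ h => Subtype.ext h) hJ
  -- the value at a point of `D n` is divisible by a high power of `m + 1`, and is `a` mod `m`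
  let c : ℕ → ℤ := fun n => ((m : ℤ) + 1) ^ n * a.val
  have hc (n : ℕ) : τ (c n) = a := by simp [τ, c]
  let h : (ℕ → Bool) → ℤ := fun z => if hz : ∃ n, z ∈ D n then c hz.choose else 0
  have h_in {z n} (hz : z ∈ D n) : h z = c n := by
    have hz' : ∃ n, z ∈ D n := ⟨n, hz⟩
    have : hz'.choose = n := by
      by_contra hne
      exact (hd hne).le_bot ⟨hz'.choose_spec, hz⟩
    simp only [h, dif_pos hz', this]
  have h_out {z} (hz : ¬ ∃ n, z ∈ D n) : h z = 0 := dif_neg hz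
  convert nonempty_coding_comp (E := E) (fun s => Int.castAddHom (ZMod ((m + 1) ^ s))) τ
    (ZMod.intCast_surjective) (fun l hl => ?_) hP hJ' h fun s => ?_ using 2
  · ext z
    by_cases hz : ∃ n, z ∈ D n
    · obtain ⟨n, hn⟩ := hz
      rw [h_in hn, hc, indicator_of_mem (mem_iUnion.2 ⟨n, hn⟩)]
    · rw [h_out hz, map_zero, indicator_of_notMem (by simpa using hz)]
  · suffices l = 0 by rw [this, map_zero]
    have hdvd : (m + 1) ^ l.natAbs ∣ l.natAbs := by
      have := hl l.natAbs
      rw [Int.coe_castAddHom, ZMod.intCast_zmod_eq_zero_iff_dvd] at this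
      exact Int.natCast_dvd.1 this
    by_contra hl0
    exact absurd (Nat.le_of_dvd (Int.natAbs_pos.2 hl0) hdvd)
      (Nat.lt_pow_self (by have := Nat.pos_of_ne_zero hm; omega)).not_ge
  · have hne : (m + 1) ^ s ≠ 0 := by positivity
    obtain ⟨N, hN⟩ : ∃ N, N = (m + 1) ^ s := ⟨_, rfl⟩
    rw [← hN] at hne ⊢
    have : NeZero N := ⟨hne⟩
    have hsum (t : ℕ) : Nonempty (Coding E (∑ n ∈ Finset.range t,
        (D n).indicator fun _ => (c n : ZMod N))) := by
      induction t with
      | zero =>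
        have h0 := hD 0 N hne 0
        rw [indicator_zero] at h0
        exact h0
      | succ t ih =>
        rw [Finset.sum_range_succ]
        exact nonempty_coding_add hP (hJm N hne) ih (hD t N hne _)
    convert hsum s using 2
    ext z
    rw [Finset.sum_apply]
    by_cases hz : ∃ n, z ∈ D n
    · obtain ⟨n, hn⟩ := hz
      rw [h_in hn]
      have hother (i : ℕ) (hi : i ≠ n) : z ∉ D i := fun h' => (hd hi).le_bot ⟨h', hn⟩
      by_cases hs : n < s
      · rw [Finset.sum_eq_single_of_mem n (Finset.mem_range.2 hs) fun i _ hi =>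
          indicator_of_notMem (hother i hi) _, indicator_of_mem hn]
        rfl
      · rw [Finset.sum_eq_zero fun i hi => indicator_of_notMem (hother i ?_) _]
        · rw [Int.coe_castAddHom, ZMod.intCast_zmod_eq_zero_iff_dvd, hN]
          push_cast
          exact (pow_dvd_pow _ (not_lt.1 hs)).mul_right _
        · rintro rfl
          exact hs (Finset.mem_range.1 hi)
    · rw [h_out hz, map_zero, Finset.sum_eq_zero fun i _ =>
        indicator_of_notMem (fun h' => hz ⟨i, h'⟩) _]

end Coding

section Category

theorem measurableSet_code_apply (i : ℕ) :
    MeasurableSet {p : (ℕ → Bool) × (ℕ → Bool) | p.1 i = true} := by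
  have h : Measurable fun p : (ℕ → Bool) × (ℕ → Bool) => p.1 i :=
    (measurable_pi_apply i).comp measurable_fst
  exact h (measurableSet_singleton true)

/-- The complement step for Vaught transforms: nonmeagreness of `Sᶜ` in a basic open set. -/
theorem not_isMeagre_inter_compl_iff {G : Type*} [TopologicalSpace G] [BaireSpace G]
    [MeasurableSpace G] [BorelSpace G] {V : ℕ → Set G}
    (hV : IsTopologicalBasis (range V)) (hne : ∀ n, (V n).Nonempty) {S : Set G}
    (hS : MeasurableSet S) (n : ℕ) :
    ¬ IsMeagre (V n ∩ Sᶜ) ↔ ∃ m, V m ⊆ V n ∧ IsMeagre (V m ∩ S) := by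
  have hopen (n) : IsOpen (V n) := hV.isOpen (mem_range_self n)
  constructor
  · intro h
    obtain ⟨W, hW, hSW⟩ := hS.compl.residualEq_isOpen
    have hmeagre : IsMeagre {g | ¬ (g ∈ Sᶜ ↔ g ∈ W)} := by
      rw [IsMeagre, compl_ofPred]
      simp only [not_not]
      filter_upwards [hSW] with g hg
      exact iff_of_eq hg
    have hVW : (V n ∩ W).Nonempty := by
      rw [nonempty_iff_ne_empty]
      intro he
      have hsub : V n ∩ Sᶜ ⊆ {g | ¬ (g ∈ Sᶜ ↔ g ∈ W)} := fun g hg => mem_ofPred.2 fun hiff =>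
        notMem_empty g (he ▸ ⟨hg.1, hiff.1 hg.2⟩)
      exact h (hmeagre.mono hsub)
    obtain ⟨g, hg⟩ := hVW
    obtain ⟨_, ⟨m, rfl⟩, _, hm⟩ := hV.exists_subset_of_mem_open hg ((hopen n).inter hW)
    have hsub : V m ∩ S ⊆ {g | ¬ (g ∈ Sᶜ ↔ g ∈ W)} := fun x hx => mem_ofPred.2 fun hiff =>
      hiff.2 (hm hx.1).2 hx.2
    exact ⟨m, fun x hx => (hm hx).1, hmeagre.mono hsub⟩
  · rintro ⟨m, hmn, hm⟩ h
    refine not_isMeagre_of_isOpen (hopen m) (hne m) ((hm.union h).mono fun x hx => ?_)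
    by_cases hxS : x ∈ S
    · exact .inl ⟨hx, hxS⟩
    · exact .inr ⟨hmn hx, hxS⟩

variable {X : Type*} [MeasurableSpace X]

/-- Vaught transforms of a fixed Borel set along all pairs `(ρ g, ρ (g + θ z))` are sections of a
single Borel set. -/
theorem exists_universal_vaught {B : Set (X × X)} (hB : MeasurableSet B) :
    ∃ U : ℕ → Set ((ℕ → Bool) × (ℕ → Bool)), (∀ n, MeasurableSet (U n)) ∧
      ∀ (G : Type) [AddCommGroup G] [TopologicalSpace G] [IsTopologicalAddGroup G]
        [PolishSpace G] [MeasurableSpace G] [BorelSpace G] (V : ℕ → Set G) (ρ : G → X)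
        (θ : (ℕ → Bool) → G), IsTopologicalBasis (range V) → (∀ n, (V n).Nonempty) →
        Measurable ρ → Continuous θ →
        ∃ c, ∀ n z, (c, z) ∈ U n ↔ ¬ IsMeagre (V n ∩ {g | (ρ g, ρ (g + θ z)) ∈ B}) := by
  have hgen : (Prod.instMeasurableSpace : MeasurableSpace (X × X)) =
      .generateFrom (image2 (· ×ˢ ·) {s : Set X | MeasurableSet s} {t : Set X | MeasurableSet t}) :=
    generateFrom_prod.symm
  rw [hgen] at hB
  induction B, hB using MeasurableSpace.generateFrom_induction with
  | empty =>
    refine ⟨fun _ => ∅, fun _ => .empty, fun G _ _ _ _ _ _ V ρ θ _ _ _ _ => ⟨0, fun n z => ?_⟩⟩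
    simpa using IsMeagre.empty
  | hC t ht _ =>
    obtain ⟨O₁, hO₁, O₂, hO₂, rfl⟩ := ht
    obtain ⟨b, hbc, -, hb⟩ := TopologicalSpace.exists_countable_basis (ℕ → Bool)
    have hbne : b.Nonempty := by
      obtain ⟨s, hs, -⟩ := hb.exists_subset_of_mem_open (mem_univ (0 : ℕ → Bool)) isOpen_univ
      exact ⟨s, hs⟩
    obtain ⟨N, rfl⟩ := hbc.exists_eq_range hbne
    refine ⟨fun n => ⋃ k, {p | p.1 (Nat.pair n k) = true ∧ p.2 ∈ N k}, fun n => ?_, ?_⟩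
    · exact .iUnion fun k => .inter (measurableSet_code_apply _) <|
        measurable_snd (hb.isOpen (mem_range_self k)).measurableSet
    · intro G _ _ _ _ _ _ V ρ θ hV hne hρ hθ
      classical
      obtain ⟨W₁, hW₁, hρ₁⟩ := (hρ hO₁).residualEq_isOpen
      obtain ⟨W₂, hW₂, hρ₂⟩ := (hρ hO₂).residualEq_isOpen
      let A : ℕ → Set (ℕ → Bool) := fun n => ⋃ g ∈ V n ∩ W₁, {z | g + θ z ∈ W₂}
      have hA (n) : IsOpen (A n) := isOpen_biUnion fun g _ =>
        hW₂.preimage (continuous_const.add hθ)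
      refine ⟨fun i => decide (N i.unpair.2 ⊆ A i.unpair.1), fun n z => ?_⟩
      have hmeagre : IsMeagre {g | ¬ ((ρ g, ρ (g + θ z)) ∈ O₁ ×ˢ O₂ ↔
          g ∈ W₁ ∧ g + θ z ∈ W₂)} := by
        rw [IsMeagre, compl_ofPred]
        simp only [not_not]
        have h₂ : ∀ᶠ g in residual G, (ρ ⁻¹' O₂) (g + θ z) = W₂ (g + θ z) :=
          (tendsto_residual_of_isOpenMap (Homeomorph.addRight (θ z)).continuous
            (Homeomorph.addRight (θ z)).isOpenMap).eventually hρ₂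
        filter_upwards [hρ₁, h₂] with g hg₁ hg₂
        exact and_congr (iff_of_eq hg₁) (iff_of_eq hg₂)
      have hopen : IsOpen (V n ∩ {g | g ∈ W₁ ∧ g + θ z ∈ W₂}) :=
        (hV.isOpen (mem_range_self n)).inter
          (hW₁.inter (hW₂.preimage (continuous_id.add continuous_const)))
      have hz : z ∈ A n ↔ (V n ∩ {g | g ∈ W₁ ∧ g + θ z ∈ W₂}).Nonempty := by
        simp only [A, mem_iUnion, mem_ofPred_eq, mem_inter_iff, Set.Nonempty, exists_prop, and_assoc]
      trans z ∈ A n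
      · simp only [mem_iUnion, mem_ofPred_eq, Nat.unpair_pair, decide_eq_true_eq]
        constructor
        · rintro ⟨k, hk, hzk⟩
          exact hk hzk
        · intro hzA
          obtain ⟨_, ⟨k, rfl⟩, hzk, hk⟩ := hb.exists_subset_of_mem_open hzA (hA n)
          exact ⟨k, hk, hzk⟩
      · rw [hz]
        constructor
        · intro hn hm
          refine not_isMeagre_of_isOpen hopen hn ((hm.union hmeagre).mono fun g hg => ?_)
          by_cases h : (ρ g, ρ (g + θ z)) ∈ O₁ ×ˢ O₂
          · exact .inl ⟨hg.1, h⟩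
          · exact .inr fun hiff => h (hiff.2 hg.2)
        · intro hm
          by_contra he
          rw [not_nonempty_iff_eq_empty] at he
          have hsub : V n ∩ {g | (ρ g, ρ (g + θ z)) ∈ O₁ ×ˢ O₂} ⊆
              {g | ¬ ((ρ g, ρ (g + θ z)) ∈ O₁ ×ˢ O₂ ↔ g ∈ W₁ ∧ g + θ z ∈ W₂)} :=
            fun g hg => mem_ofPred.2 fun hiff => notMem_empty g (he ▸ ⟨hg.1, hiff.1 hg.2⟩)
          exact hm (hmeagre.mono hsub)
  | compl t ht ih =>
    obtain ⟨U, hU, hUc⟩ := ih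
    -- a code consists of a code for `t` and of the inclusion relation of the basis
    let d : (ℕ → Bool) × (ℕ → Bool) → (ℕ → Bool) × (ℕ → Bool) := fun p =>
      (fun i => p.1 (2 * i), p.2)
    have hd : Measurable d := by
      refine (measurable_pi_lambda _ fun i => ?_).prodMk measurable_snd
      exact (measurable_pi_apply _).comp measurable_fst
    refine ⟨fun n => ⋃ m, {p | p.1 (2 * Nat.pair m n + 1) = true ∧ p ∉ d ⁻¹' U m}, fun n => ?_, ?_⟩
    · exact .iUnion fun m => .inter (measurableSet_code_apply _) (hd (hU m)).compl
    · intro G _ _ _ _ _ _ V ρ θ hV hne hρ hθ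
      classical
      obtain ⟨c, hc⟩ := hUc G V ρ θ hV hne hρ hθ
      let c' : ℕ → Bool := fun i => if i % 2 = 0 then c (i / 2) else
        decide (V (i / 2).unpair.1 ⊆ V (i / 2).unpair.2)
      have hc0 (i) : c' (2 * i) = c i := by
        simp [c']
      have hc1 (i) : c' (2 * i + 1) = decide (V i.unpair.1 ⊆ V i.unpair.2) := by
        have h1 : (2 * i + 1) % 2 ≠ 0 := by omega
        have h2 : (2 * i + 1) / 2 = i := by omega
        simp only [c', if_neg h1, h2]
      refine ⟨c', fun n z => ?_⟩
      have hS : MeasurableSet {g | (ρ g, ρ (g + θ z)) ∈ t} := by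
        refine (hρ.prodMk (hρ.comp (measurable_id.add_const (θ z)))) ?_
        rw [← hgen] at ht
        exact ht
      have := not_isMeagre_inter_compl_iff hV hne hS n
      rw [show {g | (ρ g, ρ (g + θ z)) ∈ tᶜ} = {g | (ρ g, ρ (g + θ z)) ∈ t}ᶜ from rfl, this]
      simp only [mem_iUnion, mem_ofPred_eq, hc1, Nat.unpair_pair, decide_eq_true_eq, mem_preimage,
        d, hc0, hc, not_not]
  | iUnion t _ ih =>
    choose U hU hUc using ih
    let d : ℕ → (ℕ → Bool) × (ℕ → Bool) → (ℕ → Bool) × (ℕ → Bool) := fun k p =>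
      (fun i => p.1 (Nat.pair k i), p.2)
    have hd (k) : Measurable (d k) := by
      refine (measurable_pi_lambda _ fun i => ?_).prodMk measurable_snd
      exact (measurable_pi_apply _).comp measurable_fst
    refine ⟨fun n => ⋃ k, d k ⁻¹' U k n, fun n => .iUnion fun k => hd k (hU k n), ?_⟩
    intro G _ _ _ _ _ _ V ρ θ hV hne hρ hθ
    choose c hc using fun k => hUc k G V ρ θ hV hne hρ hθ
    refine ⟨fun i => c i.unpair.1 i.unpair.2, fun n z => ?_⟩
    have hun : V n ∩ {g | (ρ g, ρ (g + θ z)) ∈ ⋃ k, t k} =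
        ⋃ k, V n ∩ {g | (ρ g, ρ (g + θ z)) ∈ t k} := by
      rw [← inter_iUnion]
      congr 1
      ext g
      simp
    have hm : IsMeagre (⋃ k, V n ∩ {g | (ρ g, ρ (g + θ z)) ∈ t k}) ↔
        ∀ k, IsMeagre (V n ∩ {g | (ρ g, ρ (g + θ z)) ∈ t k}) :=
      ⟨fun h k => h.mono fun _ hg => mem_iUnion.2 ⟨k, hg⟩, isMeagre_iUnion⟩
    rw [hun, hm, not_forall]
    simp only [mem_iUnion, mem_preimage, d, Nat.unpair_pair, hc]

theorem exists_not_codedSet {E : X → X → Prop}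
    (hEBorel : MeasurableSet {p : X × X | E p.1 p.2}) {I : Set ℕ} {m : ℕ} (hm : m ∈ I)
    (hm1 : m ≠ 1) : ∃ D : Set (ℕ → Bool), MeasurableSet D ∧ ¬ CodedSet E I D := by
  obtain ⟨U, hU, hUc⟩ := exists_universal_vaught hEBorel
  refine ⟨{z | (z, z) ∈ U 0}, (measurable_id.prodMk measurable_id) (hU 0), fun hD => ?_⟩
  obtain ⟨C⟩ := hD m hm 1
  obtain ⟨b, hbc, hb0, hb⟩ := TopologicalSpace.exists_countable_basis C.G
  have hbne : b.Nonempty := by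
    obtain ⟨s, hs, -⟩ := hb.exists_subset_of_mem_open (mem_univ (0 : C.G)) isOpen_univ
    exact ⟨s, hs⟩
  obtain ⟨V, rfl⟩ := hbc.exists_eq_range hbne
  have hV (n) : (V n).Nonempty := by
    rw [nonempty_iff_ne_empty]
    exact fun h => hb0 ⟨n, h⟩
  obtain ⟨c, hc⟩ := hUc C.G V C.ρ C.θ hb hV C.measurable_ρ C.continuous_θ
  have hrel (g : C.G) : E (C.ρ g) (C.ρ (g + C.θ c)) ↔ (C.θ c, 0) ∈ C.graph := by
    rw [C.rel_iff, sub_add_cancel_left, ← C.graph.neg_mem_iff]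
    simp
  have hcU := hc 0 c
  simp only [mem_ofPred_eq, hrel] at hcU
  by_cases h : (c, c) ∈ U 0
  · have hg : (C.θ c, 0) ∈ C.graph := by
      by_contra hg
      refine hcU.1 h ?_
      simpa [hg] using IsMeagre.empty
    have h1 := C.mem_graph c
    rw [indicator_of_mem (by exact h)] at h1
    have h01 := C.eq_zero 1 (by simpa using C.graph.sub_mem h1 hg)
    have := (ZMod.natCast_eq_zero_iff 1 m).1 (by simpa using h01)
    exact hm1 (Nat.dvd_one.1 this)
  · have h1 := C.mem_graph c
    rw [indicator_of_notMem (by exact h)] at h1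
    refine h (hcU.2 ?_)
    simpa [h1] using not_isMeagre_of_isOpen (hb.isOpen (mem_range_self 0)) (hV 0)

end Category

end GammaJump

/-- Let `Γ` be a countable group such that `ℤ` or `⊕_{n∈ℕ} ℤ/pℤ` (for
some prime `p`) is a quotient of a subgroup of `Γ`.  Then for every Borel equivalence
relation `E` on a standard Borel space with at least two classes, `E <_B E^{[Γ]}`:
`E` is Borel reducible to `E^{[Γ]}` but `E^{[Γ]}` is not Borel reducible to `E`. -/
theorem gammaJump_proper
    {Γ : Type*} [Group Γ] [Countable Γ]
    (hΓ : ∃ Λ : Subgroup Γ,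
      (∃ π : Λ →* Multiplicative ℤ, Function.Surjective π) ∨
      (∃ p : ℕ, p.Prime ∧
        ∃ π : Λ →* Multiplicative (ℕ →₀ ZMod p), Function.Surjective π))
    {X : Type*} [MeasurableSpace X] [StandardBorelSpace X]
    (E : X → X → Prop) (hE : Equivalence E)
    (hEBorel : MeasurableSet {p : X × X | E p.1 p.2})
    (htwo : ∃ a b : X, ¬ E a b) :
    BorelReducible E (GammaJump Γ E) ∧ ¬ BorelReducible (GammaJump Γ E) E := by
  refine ⟨GammaJump.borelReducible_gammaJump Γ E, fun hJ => ?_⟩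
  obtain ⟨Λ, ⟨π, hπ⟩ | ⟨p, hp, π, hπ⟩⟩ := hΓ
  · have : Infinite Γ :=
      have := Infinite.of_surjective π hπ
      .of_injective _ (Subtype.val_injective (p := (· ∈ Λ)))
    have hS := GammaJump.hasSpareClass hE htwo hJ
    have hP := GammaJump.absorbs_power hS hE hJ
    have hΛ := GammaJump.absorbs_of_injective hE hS Λ.subtype Λ.subtype_injective hJ
    have hQ := GammaJump.absorbs_of_surjective π hπ hΛ
    have hm (m : ℕ) (_ : m ≠ 0) := GammaJump.absorbs_of_surjective
      (Int.castAddHom (ZMod m)).toMultiplicative ZMod.intCast_surjective hQ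
    obtain ⟨D, hD, hD'⟩ := GammaJump.exists_not_codedSet hEBorel
      (I := {m | m ≠ 0}) (m := 2) two_ne_zero (by decide)
    exact hD' (GammaJump.codedSet_of_measurableSet hE htwo hP (fun _ h => h) hm
      (GammaJump.codedSet_iUnion_int hP hS hE hQ hm) hD)
  · have : NeZero p := ⟨hp.ne_zero⟩
    have : Fact (1 < p) := ⟨hp.one_lt⟩
    have : Infinite Γ :=
      have : Infinite (Multiplicative (ℕ →₀ ZMod p)) := inferInstanceAs (Infinite (ℕ →₀ ZMod p))
      have := Infinite.of_surjective π hπ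
      .of_injective _ (Subtype.val_injective (p := (· ∈ Λ)))
    have hS := GammaJump.hasSpareClass hE htwo hJ
    have hP := GammaJump.absorbs_power hS hE hJ
    have hΛ := GammaJump.absorbs_of_injective hE hS Λ.subtype Λ.subtype_injective hJ
    have hQ := GammaJump.absorbs_of_surjective π hπ hΛ
    have hm (m : ℕ) (h : m ∈ ({p} : Set ℕ)) :
        BorelReducible (GammaJump (Multiplicative (ZMod m)) E) E := by
      obtain rfl : m = p := h
      exact GammaJump.absorbs_of_surjective (Finsupp.applyAddHom 0).toMultiplicative
        (fun a => ⟨Multiplicative.ofAdd (.single 0 a.toAdd), by simp⟩) hQ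
    obtain ⟨D, hD, hD'⟩ := GammaJump.exists_not_codedSet hEBorel
      (Set.mem_singleton p) hp.ne_one
    exact hD' (GammaJump.codedSet_of_measurableSet hE htwo hP
      (by rintro m rfl; exact NeZero.ne m) hm
      (GammaJump.codedSet_iUnion_singleton hP hS hE hQ) hD)
end

section
/- Let Γ be a countably infinite group and let E_0^{[Γ]} be the Γ-jump of E_0, an equivalence relation on ((2^ω))^Γ. Then E_0^{[Γ]} is generically F-ergodic for every countable Borel equivalence relation F on a Polish space: for every such F and every Baire measurable homomorphism φ from E_0^{[Γ]} to F, there is a point y in the domain of F such that φ⁻¹([y]_F) is comeager. (Equivalently, E_0^{[Γ]} is generically E_∞-ergodic, where E_∞ is a universal countable Borel equivalence relation.) -/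
/-- `E₀`: eventual agreement on `2^ω`. -/
def E0 : (ℕ → Bool) → (ℕ → Bool) → Prop :=
  fun x y => ∀ᶠ n in Filter.atTop, x n = y n

/-- A set has the Baire property if it differs from an open set by a meager set. -/
def HasBaireProperty {Z : Type*} [TopologicalSpace Z] (s : Set Z) : Prop :=
  ∃ u : Set Z, IsOpen u ∧ IsMeagre (symmDiff s u)

open Filter Topology Set

/-- The Cantor-space point `x` with its `n`-th bit flipped for each `n` in the binary
support of `m`. -/
def bitFlip (m : ℕ) (x : ℕ → Bool) : ℕ → Bool :=
  fun n => xor (x n) (m.testBit n)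

lemma bitFlip_bitFlip (m : ℕ) (x : ℕ → Bool) : bitFlip m (bitFlip m x) = x := by
  funext n
  simp [bitFlip]

lemma E0_bitFlip (m : ℕ) (x : ℕ → Bool) : E0 x (bitFlip m x) := by
  filter_upwards [eventually_ge_atTop m] with n hn
  simp [bitFlip, Nat.testBit_lt_two_pow (hn.trans_lt n.lt_two_pow_self)]

lemma continuous_bitFlip : Continuous fun p : ℕ × (ℕ → Bool) => bitFlip p.1 p.2 := by
  refine continuous_pi fun n => ?_
  have hxor : Continuous fun b : Bool × Bool => xor b.1 b.2 := continuous_of_discreteTopology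
  have hbit : Continuous fun m : ℕ => m.testBit n := continuous_of_discreteTopology
  exact hxor.comp (((continuous_apply n).comp continuous_snd).prodMk
    (hbit.comp continuous_fst) : Continuous fun p : ℕ × (ℕ → Bool) => (p.2 n, p.1.testBit n))

lemma exists_bitFlip_mem (x : ℕ → Bool) {t : Set (ℕ → Bool)} (ht : IsOpen t)
    (hne : t.Nonempty) : ∃ m, bitFlip m x ∈ t := by
  obtain ⟨w, hw⟩ := hne
  obtain ⟨I, u, hu, hsub⟩ := isOpen_pi_iff.1 ht w hw
  refine ⟨Finset.equivBitIndices.symm (I.filter fun n => x n ≠ w n), hsub fun n hn => ?_⟩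
  have hn' : n ∈ I := hn
  have : bitFlip (Finset.equivBitIndices.symm (I.filter fun n => x n ≠ w n)) x n = w n := by
    have hbit (m : ℕ) : m.testBit n = decide (n ∈ Finset.equivBitIndices m) := by simp
    rw [bitFlip, hbit, Equiv.apply_symm_apply]
    cases hx : x n <;> cases hw : w n <;> simp [hn', hx, hw]
  rw [this]
  exact (hu n hn).2

/-- The coordinatewise action of `Γ → ℕ` by bit flips. -/
def flipAll {Γ : Type*} (h : Γ → ℕ) (x : Γ → ℕ → Bool) : Γ → ℕ → Bool :=
  fun α => bitFlip (h α) (x α)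

lemma continuous_flipAll {Γ : Type*} :
    Continuous fun p : (Γ → ℕ → Bool) × (Γ → ℕ) => flipAll p.2 p.1 :=
  continuous_pi fun α => continuous_bitFlip.comp
    (f := fun p : (Γ → ℕ → Bool) × (Γ → ℕ) => (p.2 α, p.1 α)) (by fun_prop)

lemma isOpenMap_flipAll {Γ : Type*} :
    IsOpenMap fun p : (Γ → ℕ → Bool) × (Γ → ℕ) => flipAll p.2 p.1 := by
  have hinv (h : Γ → ℕ) (x) : flipAll h (flipAll h x) = x :=
    funext fun α => bitFlip_bitFlip _ _
  refine IsOpenMap.of_sections fun p => ⟨fun z => (flipAll p.2 z, p.2), ?_, ?_, ?_⟩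
  · exact ((continuous_flipAll.comp (continuous_id.prodMk continuous_const)).prodMk
      continuous_const).continuousAt
  · exact Prod.ext (hinv _ _) rfl
  · exact fun z => hinv _ _

/-- The half of the Kuratowski–Ulam theorem that needs no Baire property, pulled back along a
continuous open map. -/
lemma eventually_residual_eventually_residual {A B Z : Type*} [TopologicalSpace A]
    [TopologicalSpace B] [SecondCountableTopology B] [TopologicalSpace Z] {f : A × B → Z}
    (hc : Continuous f) (ho : IsOpenMap f) {R : Set Z} (hR : R ∈ residual Z) :
    ∀ᶠ a in residual A, ∀ᶠ b in residual B, f (a, b) ∈ R := by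
  obtain ⟨𝒰, hopen, hdense, hcount, hsub⟩ := mem_residual_iff.1 hR
  have key : ∀ U ∈ 𝒰, ∀ᶠ a in residual A, ∀ᶠ b in residual B, f (a, b) ∈ U := by
    intro U hU
    have hslice : ∀ᶠ a in residual A, ∀ V ∈ TopologicalSpace.countableBasis B,
        ∃ b ∈ V, f (a, b) ∈ U := by
      rw [eventually_countable_ball (TopologicalSpace.countable_countableBasis B)]
      intro V hV
      have hVo := TopologicalSpace.isOpen_of_mem_countableBasis hV
      have hO : IsOpen {a : A | ∃ b ∈ V, f (a, b) ∈ U} := by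
        convert isOpenMap_fst _ (((hopen U hU).preimage hc).inter (hVo.preimage continuous_snd))
          using 1
        ext a
        simp [and_comm]
      refine residual_of_dense_open hO (dense_iff_inter_open.2 fun W hW ⟨a, ha⟩ => ?_)
      obtain ⟨b, hb⟩ := TopologicalSpace.nonempty_of_mem_countableBasis hV
      obtain ⟨_, hzU, ⟨⟨a', b'⟩, ⟨ha', hb'⟩, rfl⟩⟩ :=
        (hdense U hU).exists_mem_open (ho _ (hW.prod hVo)) ⟨_, (a, b), ⟨ha, hb⟩, rfl⟩
      exact ⟨a', ha', b', hb', hzU⟩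
    filter_upwards [hslice] with a ha
    refine residual_of_dense_open ((hopen U hU).preimage (hc.comp (Continuous.prodMk_right a))) ?_
    refine (TopologicalSpace.isBasis_countableBasis B).dense_iff.2 fun V hV _ => ?_
    obtain ⟨b, hb, hbU⟩ := ha V hV
    exact ⟨b, hb, hbU⟩
  rw [← eventually_countable_ball hcount] at key
  filter_upwards [key] with a ha
  rw [← eventually_countable_ball hcount] at ha
  filter_upwards [ha] with b hb
  exact hsub (mem_sInter.2 hb)

/-- On the fibre of points agreeing with `x` on `S`, the set `U` is empty or dense. -/
def FiberEmptyOrDense {Γ Z : Type*} [TopologicalSpace Z] (S : Finset Γ) (U : Set (Γ → Z))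
    (x : Γ → Z) : Prop :=
  ∀ w ∈ U, EqOn w x S → ∀ W : Set (Γ → Z), IsOpen W → ∀ v ∈ W, EqOn v x S →
    ∃ w' ∈ W ∩ U, EqOn w' x S

lemma FiberEmptyOrDense.mem_of_mem {Γ Z : Type*} [TopologicalSpace Z] {S : Finset Γ}
    {U : Set (Γ → Z)} {x x₀ x₁ : Γ → Z} (h : FiberEmptyOrDense S U x) (hU : IsOpen U)
    (h₀ : EqOn x₀ x S) (h₁ : EqOn x₁ x S) (hx₀ : x₀ ∈ U) (hx₁ : x₁ ∉ frontier U) : x₁ ∈ U := by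
  by_contra hn
  have hcl : x₁ ∈ (closure U)ᶜ := fun hc => hx₁ ⟨hc, by rwa [hU.interior_eq]⟩
  obtain ⟨w, hw, -⟩ := h x₀ hx₀ h₀ _ isClosed_closure.isOpen_compl x₁ hcl h₁
  exact hw.1 (subset_closure hw.2)

/-- `W` meets the orbit of `x` under the flips extending `h₀` on `S`, as soon as it meets the
fibre of `flipAll h₀ x` over `S`; moreover such flips can be found in any set dense among them. -/
lemma exists_flipAll_mem {Γ : Type*} {S : Finset Γ} {h₀ : Γ → ℕ} {B : Set (Γ → ℕ)}
    (hB : {h | EqOn h h₀ S} ⊆ closure B) (x : Γ → ℕ → Bool) {W : Set (Γ → ℕ → Bool)}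
    (hW : IsOpen W) {v : Γ → ℕ → Bool} (hv : v ∈ W) (hvS : EqOn v (flipAll h₀ x) S) :
    ∃ h ∈ B, EqOn h h₀ S ∧ flipAll h x ∈ W := by
  classical
  obtain ⟨T, t, ht, hsub⟩ := isOpen_pi_iff.1 hW v hv
  have hex : ∀ α, ∃ m, (α ∈ T → bitFlip m (x α) ∈ t α) ∧ (α ∈ S → m = h₀ α) := by
    intro α
    by_cases hS : α ∈ S
    · refine ⟨h₀ α, fun hT => ?_, fun _ => rfl⟩
      have := hvS hS
      rw [flipAll] at this
      exact this ▸ (ht α hT).2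
    · by_cases hT : α ∈ T
      · obtain ⟨m, hm⟩ := exists_bitFlip_mem (x α) (ht α hT).1 ⟨_, (ht α hT).2⟩
        exact ⟨m, fun _ => hm, fun h => absurd h hS⟩
      · exact ⟨0, fun h => absurd h hT, fun h => absurd h hS⟩
  choose h hT hS using hex
  have hopen : IsOpen {h | EqOn h h₀ S} := by
    convert isOpen_set_pi (i := (S : Set Γ)) (s := fun α => {h₀ α}) S.finite_toSet
      fun _ _ => isOpen_discrete _ using 1
    ext h
    simp [EqOn]
  have hWpre : IsOpen {h | flipAll h x ∈ W} :=
    hW.preimage (continuous_flipAll.comp (continuous_const.prodMk continuous_id))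
  obtain ⟨h', ⟨h1, h2⟩, h3⟩ := mem_closure_iff.1 (hB (fun α hα => hS α hα : EqOn h h₀ S)) _
    (hopen.inter hWpre) ⟨fun α hα => hS α hα, hsub fun α hα => hT α hα⟩
  exact ⟨h', h3, h1, h2⟩

/-- If `φ` takes countably many values on each orbit of the flips, then generically the orbit of
`x` contains a point of `R` over whose fibre, for some finite `S`, all the given sets are empty
or dense. -/
lemma eventually_exists_fiberEmptyOrDense {Γ Y : Type*} [Countable Γ] {φ : (Γ → ℕ → Bool) → Y}
    (hφ : ∀ x, (range fun h => φ (flipAll h x)).Countable) {ι : Type*}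
    {V : ι → Set Y} {U : ι → Set (Γ → ℕ → Bool)} (hU : ∀ i, IsOpen (U i))
    {R : Set (Γ → ℕ → Bool)} (hR : R ∈ residual _)
    (hRU : ∀ x ∈ R, ∀ i, φ x ∈ V i ↔ x ∈ U i) :
    ∀ᶠ x in residual (Γ → ℕ → Bool), ∃ h, flipAll h x ∈ R ∧ ∃ S : Finset Γ, ∀ i,
      FiberEmptyOrDense S (U i) (flipAll h x) := by
  filter_upwards [eventually_residual_eventually_residual continuous_flipAll isOpenMap_flipAll hR]
    with x hx
  let B (y : Y) : Set (Γ → ℕ) := {h | flipAll h x ∈ R ∧ φ (flipAll h x) = y}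
  obtain ⟨y, hy⟩ : ∃ y, ¬ IsNowhereDense (B y) := by
    by_contra! hall
    have hmeagre : IsMeagre (⋃ y ∈ range fun h => φ (flipAll h x), B y) :=
      isMeagre_biUnion (hφ x) fun y _ => (hall y).isMeagre
    obtain ⟨h, hh, hh'⟩ := (dense_of_mem_residual (inter_mem hx hmeagre)).nonempty
    exact hh' (mem_biUnion (mem_range_self h) ⟨hh, rfl⟩)
  obtain ⟨k, hk⟩ := nonempty_iff_ne_empty.2 hy
  obtain ⟨h₀, hh₀, hB₀⟩ := mem_closure_iff.1 (interior_subset hk) _ isOpen_interior hk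
  obtain ⟨S, u, hu, hsub⟩ := isOpen_pi_iff.1 isOpen_interior h₀ hh₀
  have hcl : {h | EqOn h h₀ S} ⊆ closure (B y) := fun h hh =>
    interior_subset (hsub fun α hα => by rw [hh hα]; exact (hu α hα).2)
  refine ⟨h₀, hB₀.1, S, fun i w hw hwS W hW v hv hvS => ?_⟩
  obtain ⟨h₁, hh₁, -, hm₁⟩ := exists_flipAll_mem hcl x (hU i) hw hwS
  obtain ⟨h₂, hh₂, he₂, hm₂⟩ := exists_flipAll_mem hcl x hW hv hvS
  refine ⟨flipAll h₂ x, ⟨hm₂, ?_⟩, fun α hα => by simp only [flipAll, he₂ hα]⟩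
  rw [← hRU _ hh₂.1 i, hh₂.2, ← hh₁.2, hRU _ hh₁.1 i]
  exact hm₁

/-- The point equal to `x'` translated by `γ⁻¹` on `γ⁻¹ S`, and to `x` elsewhere. -/
noncomputable def graft {Γ Z : Type*} [Group Γ] (S : Finset Γ) (γ : Γ) (p : (Γ → Z) × (Γ → Z)) :
    Γ → Z :=
  open Classical in fun α => if γ * α ∈ S then p.2 (γ * α) else p.1 α

lemma continuous_graft {Γ Z : Type*} [Group Γ] [TopologicalSpace Z] (S : Finset Γ) (γ : Γ) :
    Continuous (graft S γ : (Γ → Z) × (Γ → Z) → Γ → Z) := by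
  refine continuous_pi fun α => ?_
  by_cases h : γ * α ∈ S <;> simp only [graft, h, if_true, if_false] <;> fun_prop

lemma isOpenMap_graft {Γ Z : Type*} [Group Γ] [TopologicalSpace Z] (S : Finset Γ) (γ : Γ) :
    IsOpenMap (graft S γ : (Γ → Z) × (Γ → Z) → Γ → Z) := by
  classical
  refine IsOpenMap.of_sections fun p => ⟨fun z => (fun α => if γ * α ∈ S then p.1 α else z α,
    fun β => if β ∈ S then z (γ⁻¹ * β) else p.2 β), ?_, ?_, ?_⟩
  · refine Continuous.continuousAt (.prodMk (continuous_pi fun α => ?_) (continuous_pi fun β => ?_))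
    · by_cases h : γ * α ∈ S <;> simp only [h, if_true, if_false] <;> fun_prop
    · by_cases h : β ∈ S <;> simp only [h, if_true, if_false] <;> fun_prop
  · refine Prod.ext (funext fun α => ?_) (funext fun β => ?_)
    · by_cases h : γ * α ∈ S <;> simp [graft, h]
    · by_cases h : β ∈ S <;> simp [graft, h]
  · intro z
    funext α
    by_cases h : γ * α ∈ S <;> simp [graft, h]

lemma eventually_residual_forall_translate {Γ Z : Type*} [Group Γ] [Countable Γ]
    [TopologicalSpace Z] {R : Set (Γ → Z)} (hR : R ∈ residual _) :
    ∀ᶠ x in residual (Γ → Z), ∀ γ : Γ, (fun α => x (γ⁻¹ * α)) ∈ R := by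
  refine eventually_countable_forall.2 fun γ => ?_
  have hc (γ : Γ) : Continuous fun (x : Γ → Z) α => x (γ * α) := by fun_prop
  refine tendsto_residual_of_isOpenMap (hc γ⁻¹) (IsOpenMap.of_sections fun x =>
    ⟨fun z α => z (γ * α), (hc γ).continuousAt, ?_, fun z => ?_⟩) hR
  · funext α; simp
  · funext α; simp

lemma exists_forall_mul_notMem {Γ : Type*} [Group Γ] [Infinite Γ] (S T : Finset Γ) :
    ∃ γ : Γ, ∀ α ∈ S, γ * α ∉ T := by
  classical
  obtain ⟨γ, hγ⟩ := Infinite.exists_notMem_finset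
    (Finset.image (fun p : Γ × Γ => p.1 * p.2⁻¹) (T ×ˢ S))
  refine ⟨γ, fun α hα hT => hγ (Finset.mem_image.2 ⟨(γ * α, α), ?_, by simp⟩)⟩
  exact Finset.mem_product.2 ⟨hT, hα⟩

/-- For any countably infinite group `Γ`, the jump `E₀^{[Γ]}` (on
`(2^ω)^Γ`, with its product Polish topology) is generically `F`-ergodic for every
countable Borel equivalence relation `F` on a Polish space: every Baire measurable
homomorphism `φ` from `E₀^{[Γ]}` to `F` maps a comeager set into a single `F`-class. -/
theorem e0_gammaJump_generically_ergodic
    (Γ : Type*) [Group Γ] [Countable Γ] [Infinite Γ]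
    {Y : Type*} [TopologicalSpace Y] [PolishSpace Y] [MeasurableSpace Y] [BorelSpace Y]
    (F : Y → Y → Prop) (hF : Equivalence F)
    (hFBorel : MeasurableSet {p : Y × Y | F p.1 p.2})
    (hFctble : ∀ y : Y, {z : Y | F y z}.Countable)
    (φ : (Γ → ℕ → Bool) → Y)
    (hφBaire : ∀ U : Set Y, IsOpen U → HasBaireProperty (φ ⁻¹' U))
    (hφhom : ∀ x x', GammaJump Γ E0 x x' → F (φ x) (φ x')) :
    ∃ y : Y, φ ⁻¹' {z : Y | F y z} ∈ residual (Γ → ℕ → Bool) := by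
  choose U hUo hU using fun b : TopologicalSpace.countableBasis Y =>
    hφBaire b (TopologicalSpace.isOpen_of_mem_countableBasis b.2)
  have hgood : ∀ᶠ x in residual (Γ → ℕ → Bool), ∀ b : TopologicalSpace.countableBasis Y,
      (φ x ∈ (b : Set Y) ↔ x ∈ U b) ∧ x ∉ frontier (U b) := by
    have : Countable (TopologicalSpace.countableBasis Y) :=
      (TopologicalSpace.countable_countableBasis Y).to_subtype
    refine eventually_countable_forall.2 fun b => ?_
    have hfr : (frontier (U b))ᶜ ∈ residual (Γ → ℕ → Bool) :=
      residual_of_dense_open isClosed_frontier.isOpen_compl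
        (interior_eq_empty_iff_dense_compl.1
          (frontier_compl (U b) ▸ interior_frontier (hUo b).isClosed_compl))
    filter_upwards [hU b, hfr] with x hx hx'
    refine ⟨?_, hx'⟩
    by_contra hne
    refine hx (mem_symmDiff.2 ?_)
    rw [mem_preimage]
    tauto
  obtain ⟨C, hC, hCU, hCshift⟩ : ∃ C ∈ residual (Γ → ℕ → Bool),
      (∀ x ∈ C, ∀ b : TopologicalSpace.countableBasis Y,
        (φ x ∈ (b : Set Y) ↔ x ∈ U b) ∧ x ∉ frontier (U b)) ∧
      ∀ x ∈ C, ∀ γ : Γ, (fun α => x (γ⁻¹ * α)) ∈ C := by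
    refine ⟨_, eventually_residual_forall_translate hgood, fun x hx => ?_, fun x hx γ δ => ?_⟩
    · simpa using hx 1
    · simpa [mul_assoc] using hx (δ * γ)
  have hflip (h : Γ → ℕ) (x : Γ → ℕ → Bool) : F (φ x) (φ (flipAll h x)) :=
    hφhom _ _ ⟨1, fun α => by simpa [flipAll] using E0_bitFlip (h α) (x α)⟩
  have hshift (γ : Γ) (x : Γ → ℕ → Bool) : F (φ x) (φ fun α => x (γ⁻¹ * α)) :=
    hφhom _ _ ⟨γ, fun α => Eventually.of_forall fun n => rfl⟩
  have horbit (x : Γ → ℕ → Bool) : (range fun h => φ (flipAll h x)).Countable :=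
    (hFctble (φ x)).mono (range_subset_iff.2 fun h => hflip h x)
  have heq {S : Finset Γ} {x x' : Γ → ℕ → Bool} (hx : x ∈ C) (hx' : x' ∈ C)
      (hxx' : EqOn x' x S) (hS : ∀ b, FiberEmptyOrDense S (U b) x) : φ x = φ x' := by
    by_contra hne
    obtain ⟨b, hb, hxb, hb'⟩ :=
      (TopologicalSpace.isBasis_countableBasis Y).exists_subset_of_mem_open
      (show φ x ∈ ({φ x'}ᶜ : Set Y) from hne) isClosed_singleton.isOpen_compl
    have h₁ := ((hCU x hx ⟨b, hb⟩).1).1 hxb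
    have h₂ := (hS ⟨b, hb⟩).mem_of_mem (hUo _) (fun _ _ => rfl) hxx' h₁ (hCU x' hx' _).2
    exact hb' (((hCU x' hx' ⟨b, hb⟩).1).2 h₂) rfl
  have hgraft : ∀ᶠ x in residual (Γ → ℕ → Bool), ∀ (S : Finset Γ) (γ : Γ),
      ∀ᶠ x' in residual (Γ → ℕ → Bool), graft S γ (x, x') ∈ C :=
    eventually_countable_forall.2 fun S => eventually_countable_forall.2 fun γ =>
      eventually_residual_eventually_residual (continuous_graft S γ) (isOpenMap_graft S γ) hC
  obtain ⟨x, h, ⟨hx, hxgraft⟩, S, hS⟩ := (dense_of_mem_residual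
    (eventually_exists_fiberEmptyOrDense horbit hUo (V := Subtype.val)
      (inter_mem hC hgraft) fun x hx b => (hCU x hx.1 b).1)).nonempty
  refine ⟨φ (flipAll h x), ?_⟩
  have hxgraft' : ∀ᶠ x' in residual (Γ → ℕ → Bool), ∀ (S : Finset Γ) (γ : Γ),
      graft S γ (flipAll h x, x') ∈ C :=
    eventually_countable_forall.2 fun S => eventually_countable_forall.2 fun γ => hxgraft S γ
  filter_upwards [eventually_exists_fiberEmptyOrDense horbit hUo (V := Subtype.val)
    (inter_mem hC hxgraft') fun x hx b => (hCU x hx.1 b).1]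
  rintro x' ⟨h', ⟨hx', hz⟩, S', hS'⟩
  obtain ⟨γ, hγ⟩ := exists_forall_mul_notMem S S'
  have hzC := hz S' γ
  have e₁ := heq hx hzC (fun α hα => by simp [graft, hγ α hα]) hS
  have e₂ := heq hx' (hCshift _ hzC γ)
    (fun α hα => by simp [graft, Finset.mem_coe.1 hα]) hS'
  have h₁ := hshift γ (graft S' γ (flipAll h x, flipAll h' x'))
  rw [← e₁, ← e₂] at h₁
  exact hF.trans h₁ (hF.symm (hflip h' x'))
end
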